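/- arXiv:1604.05201 — 2 statements merged into one kernel-verified Lean document; each statement's English description precedes it below -/
import Mathlib

section
/- There exists a constant C > 0, independent of ε and n, such that for every ε ∈ (0,1] and every integer n ≥ 4 divisible by 4, the solution u of the continuous linear problem and the unique solution y of the discrete scheme on the Shishkin mesh with γ₀ = min{√β, 1} satisfy max_{0≤i≤n} |u(x_i) − y_i| ≤ C n^{−2} (ln n)². -/
open Set Real

noncomputable section

/-- first partial derivative of `f(x,u)` with respect to `u` -/
def pderiv1 (f : ℝ → ℝ → ℝ) (x y : ℝ) : ℝ := deriv (fun z => f x z) y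

/-- second partial derivative of `f(x,u)` with respect to `u` -/
def pderiv2 (f : ℝ → ℝ → ℝ) (x y : ℝ) : ℝ :=
  deriv (fun z => deriv (fun w => f x w) z) y

/-- `f` is four times continuously differentiable on `[0,1] × ℝ`. -/
def SmoothF (f : ℝ → ℝ → ℝ) : Prop :=
  ContDiffOn ℝ 4 (fun p : ℝ × ℝ => f p.1 p.2) ((Icc (0:ℝ) 1) ×ˢ (univ : Set ℝ))

/-- the stability condition `f_u(x,u) ≥ c₀² > 0` on `[0,1] × ℝ` -/
def LowerF (f : ℝ → ℝ → ℝ) (c₀ : ℝ) : Prop :=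
  ∀ x ∈ Icc (0:ℝ) 1, ∀ y : ℝ, c₀ ^ 2 ≤ pderiv1 f x y

/-- `u` is a C⁴-solution of the semilinear BVP `-ε²u'' + f(x,u) = 0`, `u(0)=u(1)=0`. -/
def IsSolution (f : ℝ → ℝ → ℝ) (ε : ℝ) (u : ℝ → ℝ) : Prop :=
  ContDiffOn ℝ 4 u (Icc (0:ℝ) 1) ∧
  (∀ x ∈ Ioo (0:ℝ) 1,
    -ε ^ 2 * iteratedDerivWithin 2 u (Icc (0:ℝ) 1) x + f x (u x) = 0) ∧
  u 0 = 0 ∧ u 1 = 0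

/-- the constant `l = c₀⁻² · max_{[0,1]} |f(x,0)|` -/
def lconst (f : ℝ → ℝ → ℝ) (c₀ : ℝ) : ℝ :=
  c₀ ^ (-2 : ℤ) * sSup ((fun x => |f x 0|) '' Icc (0:ℝ) 1)

/-- the constant `θ = max { |f_uu(x,ξ)| : x ∈ [0,1], |ξ| ≤ l + 2ρ }` -/
def thconst (f : ℝ → ℝ → ℝ) (c₀ ρ : ℝ) : ℝ :=
  sSup ((fun p : ℝ × ℝ => |pderiv2 f p.1 p.2|) ''
    ((Icc (0:ℝ) 1) ×ˢ (Icc (-(lconst f c₀ + 2*ρ)) (lconst f c₀ + 2*ρ))))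

/-- discrete second difference `y_{x̄x̂,i}` on a nonuniform mesh `x` (for `1 ≤ i`),
using `ℏ_i = (h_i + h_{i+1})/2 = (x_{i+1} - x_{i-1})/2`. -/
def ddiff (x y : ℕ → ℝ) (i : ℕ) : ℝ :=
  2 / (x (i+1) - x (i-1)) *
    ((y (i+1) - y i) / (x (i+1) - x i) - (y i - y (i-1)) / (x i - x (i-1)))

/-- Shishkin mesh generating function with transition parameter
`α = min(1/4, 2γ₀⁻¹ ε ln n)`. -/
def shishkinLam (γ₀ ε : ℝ) (n : ℕ) (t : ℝ) : ℝ :=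
  let α := min (1/4) (2 * γ₀⁻¹ * ε * Real.log n)
  if t ≤ 1/4 then 4*α*t
  else if t ≤ 1/2 then α + 2*(1-2*α)*(t-1/4)
  else 1 - (if 1-t ≤ 1/4 then 4*α*(1-t) else α + 2*(1-2*α)*((1-t)-1/4))

/-- Shishkin mesh nodes `x_i = λ(i/n)` -/
def shishkinMesh (γ₀ ε : ℝ) (n i : ℕ) : ℝ := shishkinLam γ₀ ε n ((i:ℝ)/(n:ℝ))

def bakhPhi (a ε q t : ℝ) : ℝ := a*ε*Real.log (q/(q-t))

/-- derivative of `bakhPhi` -/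
def bakhPhi' (a ε q t : ℝ) : ℝ := a*ε/(q-t)

/-- `α ∈ (0,q)` is the abscissa of the contact point of the tangent line from
`(1/2,1/2)` to `φ`, i.e. `φ(α) + φ'(α)(1/2 - α) = 1/2`. -/
def IsBakhAlpha (a ε q α : ℝ) : Prop :=
  α ∈ Ioo 0 q ∧ bakhPhi a ε q α + bakhPhi' a ε q α * (1/2 - α) = 1/2

/-- Bakhvalov mesh generating function -/
def bakhLam (a ε q α t : ℝ) : ℝ :=
  if t ≤ α then bakhPhi a ε q t
  else if t ≤ 1/2 then bakhPhi a ε q α + bakhPhi' a ε q α * (t-α)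
  else 1 - (if 1-t ≤ α then bakhPhi a ε q (1-t)
            else bakhPhi a ε q α + bakhPhi' a ε q α * ((1-t)-α))

/-- Bakhvalov mesh nodes `x_i = λ(i/n)` -/
def bakhMesh (a ε q α : ℝ) (n i : ℕ) : ℝ := bakhLam a ε q α ((i:ℝ)/(n:ℝ))

def vulAlpha (a ε q : ℝ) : ℝ :=
  (q - Real.sqrt (ε*a*q*(1-2*q+2*ε*a)))/(1+2*ε*a)

def vulMu (a ε q t : ℝ) : ℝ := a*ε*t/(q-t)

/-- derivative of `vulMu` -/
def vulMu' (a ε q t : ℝ) : ℝ := a*ε*q/(q-t)^2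

/-- Vulanović mesh generating function -/
def vulLam (a ε q t : ℝ) : ℝ :=
  let α := vulAlpha a ε q
  if t ≤ α then vulMu a ε q t
  else if t ≤ 1/2 then vulMu a ε q α + vulMu' a ε q α * (t-α)
  else 1 - (if 1-t ≤ α then vulMu a ε q (1-t)
            else vulMu a ε q α + vulMu' a ε q α * ((1-t)-α))

/-- Vulanović mesh nodes `x_i = λ(i/n)` -/
def vulMesh (a ε q : ℝ) (n i : ℕ) : ℝ := vulLam a ε q ((i:ℝ)/(n:ℝ))

/-- the three-point discrete scheme for the linear problem
`-ε² y_{x̄x̂,i} + b(x_i) y_i = g(x_i)`, `y_0 = y_n = 0` -/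
def LinScheme (bc gc : ℝ → ℝ) (ε : ℝ) (x : ℕ → ℝ) (n : ℕ) (y : ℕ → ℝ) : Prop :=
  (∀ i : ℕ, 1 ≤ i → i < n →
    -ε ^ 2 * ddiff x y i + bc (x i) * y i = gc (x i)) ∧
  y 0 = 0 ∧ y n = 0

/-- the nonlinear discrete scheme `-ε² y_{x̄x̂,i} + f(x_i, y_i) = 0`, `y_0 = y_n = 0` -/
def NonlinScheme (f : ℝ → ℝ → ℝ) (ε : ℝ) (x : ℕ → ℝ) (n : ℕ) (y : ℕ → ℝ) : Prop :=
  (∀ i : ℕ, 1 ≤ i → i < n → -ε ^ 2 * ddiff x y i + f (x i) (y i) = 0) ∧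
  y 0 = 0 ∧ y n = 0

/-- `u` is a C²-solution of the continuous linear problem
`-ε²u'' + b(x)u = g(x)`, `u(0)=u(1)=0`. -/
def IsLinSolution (bc gc : ℝ → ℝ) (ε : ℝ) (u : ℝ → ℝ) : Prop :=
  ContDiffOn ℝ 2 u (Icc (0:ℝ) 1) ∧
  (∀ x ∈ Ioo (0:ℝ) 1,
    -ε ^ 2 * iteratedDerivWithin 2 u (Icc (0:ℝ) 1) x + bc x * u x = gc x) ∧
  u 0 = 0 ∧ u 1 = 0

/-- `b(x,ε)` is three times continuously differentiable in `x` on `[0,1]`,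
with these derivatives bounded uniformly in `ε ∈ [0,1]`. -/
def UnifC3 (b : ℝ → ℝ → ℝ) : Prop :=
  ∃ M : ℝ, ∀ ε ∈ Icc (0:ℝ) 1,
    ContDiffOn ℝ 3 (fun x => b x ε) (Icc (0:ℝ) 1) ∧
    ∀ j : ℕ, j ≤ 3 → ∀ x ∈ Icc (0:ℝ) 1,
      |iteratedDerivWithin j (fun x => b x ε) (Icc (0:ℝ) 1) x| ≤ M

/-- `w` is the continuous piecewise-linear interpolant of mesh data `y`
on the mesh `x_0 < … < x_n`. -/
def IsLinInterp (x : ℕ → ℝ) (n : ℕ) (y : ℕ → ℝ) (w : ℝ → ℝ) : Prop :=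
  (∀ i ≤ n, w (x i) = y i) ∧
  ∀ i < n, ∀ t ∈ Icc (x i) (x (i+1)),
    w t = y i + (y (i+1) - y i) * (t - x i) / (x (i+1) - x i)

/-- properties of the initial guess `u⁰`: of class C³, within `ρ` of the
solution `u`, and satisfying ε-uniform bounds of layer type for `j = 0, 1`. -/
def InitGuess (c₀ ε C₀ ρ : ℝ) (u u0 : ℝ → ℝ) : Prop :=
  ContDiffOn ℝ 3 u0 (Icc (0:ℝ) 1) ∧
  (∀ x ∈ Icc (0:ℝ) 1, |u0 x - u x| ≤ ρ) ∧
  (∀ x ∈ Icc (0:ℝ) 1, |u0 x| ≤ C₀) ∧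
  (∀ x ∈ Icc (0:ℝ) 1, |derivWithin u0 (Icc (0:ℝ) 1) x| ≤
    C₀ * (1 + ε⁻¹ * (Real.exp (-c₀*x/ε) + Real.exp (-c₀*(1-x)/ε))))

/-- the discrete Newton (quasilinearization) iterates on the mesh `x`:
`y⁰_i = u⁰(x_i)` and `y^{m+1}` solves the quasilinearized discrete problem. -/
def NewtonIter (f : ℝ → ℝ → ℝ) (ε : ℝ) (x : ℕ → ℝ) (n : ℕ) (u0 : ℝ → ℝ)
    (Y : ℕ → ℕ → ℝ) : Prop :=
  (∀ i ≤ n, Y 0 i = u0 (x i)) ∧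
  ∀ m : ℕ,
    (∀ i : ℕ, 1 ≤ i → i < n →
      -ε ^ 2 * ddiff x (Y (m+1)) i + pderiv1 f (x i) (Y m i) * Y (m+1) i
        = -f (x i) (Y m i) + pderiv1 f (x i) (Y m i) * Y m i) ∧
    Y (m+1) 0 = 0 ∧ Y (m+1) n = 0

/-- `f'` is the (one-sided at the ends) derivative of `f` on `[p,q]`. -/
def DvOn (p q : ℝ) (f f' : ℝ → ℝ) : Prop :=
  ∀ t ∈ Icc p q, HasDerivWithinAt f (f' t) (Icc p q) t

lemma DvOn.mono {p q p' q' : ℝ} {f f' : ℝ → ℝ} (h : DvOn p q f f')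
    (hp : p ≤ p') (hq : q' ≤ q) : DvOn p' q' f f' := by
  intro t ht
  exact (h t ⟨hp.trans ht.1, ht.2.trans hq⟩).mono (Icc_subset_Icc hp hq)

lemma tay_step {p q x : ℝ} {F F' : ℝ → ℝ} (hx : x ∈ Icc p q) (hd : DvOn p q F F')
    {K : ℝ} (hK : 0 ≤ K) (k : ℕ) (hb : ∀ t ∈ Icc p q, |F' t| ≤ K * |t - x| ^ k)
    (h0 : F x = 0) : ∀ t ∈ Icc p q, |F t| ≤ K * |t - x| ^ (k+1) := by
  intro t ht
  have hsub : uIcc x t ⊆ Icc p q := by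
    intro s hs
    rcases le_total x t with h | h
    · rw [uIcc_of_le h] at hs
      exact ⟨hx.1.trans hs.1, hs.2.trans ht.2⟩
    · rw [uIcc_of_ge h] at hs
      exact ⟨ht.1.trans hs.1, hs.2.trans hx.2⟩
  have h1 := (convex_uIcc x t).norm_image_sub_le_of_norm_hasDerivWithin_le
    (f := F) (f' := F') (C := K * |t - x| ^ k)
    (fun s hs => (hd s (hsub hs)).mono hsub)
    (fun s hs => by
      rw [Real.norm_eq_abs]
      refine (hb s (hsub hs)).trans ?_
      have : |s - x| ≤ |t - x| := by
        exact abs_sub_left_of_mem_uIcc hs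
      gcongr) left_mem_uIcc right_mem_uIcc
  rw [h0, sub_zero, Real.norm_eq_abs, Real.norm_eq_abs] at h1
  rw [pow_succ, ← mul_assoc]
  exact h1

lemma tay2 {p q x : ℝ} {f0 f1 f2 : ℝ → ℝ} (hx : x ∈ Icc p q)
    (h0 : DvOn p q f0 f1) (h1 : DvOn p q f1 f2) {K : ℝ} (hK : 0 ≤ K)
    (hb : ∀ t ∈ Icc p q, |f2 t| ≤ K) :
    ∀ t ∈ Icc p q, |f0 t - f0 x - f1 x * (t - x)| ≤ K * |t - x| ^ 2 := by
  have a1 := tay_step (F := fun t => f1 t - f1 x) (F' := f2) hx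
    (fun t ht => (h1 t ht).sub_const _) hK 0 (by simpa using hb) (by simp)
  refine tay_step (F := fun t => f0 t - f0 x - f1 x * (t - x)) (F' := fun t => f1 t - f1 x) hx
    (fun t ht => ?_) hK 1 (by simpa using a1) (by simp)
  have e := ((h0 t ht).sub_const (f0 x)).sub
    (((hasDerivWithinAt_id t (Icc p q)).sub_const x).const_mul (f1 x))
  refine e.congr_deriv ?_
  simp

lemma tay3 {p q x : ℝ} {f0 f1 f2 f3 : ℝ → ℝ} (hx : x ∈ Icc p q)
    (h0 : DvOn p q f0 f1) (h1 : DvOn p q f1 f2) (h2 : DvOn p q f2 f3) {K : ℝ} (hK : 0 ≤ K)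
    (hb : ∀ t ∈ Icc p q, |f3 t| ≤ K) :
    ∀ t ∈ Icc p q, |f0 t - f0 x - f1 x * (t - x) - f2 x * ((t - x)^2 / 2)| ≤ K * |t - x| ^ 3 := by
  have a1 := tay2 hx h1 h2 hK hb
  refine tay_step (F := fun t => f0 t - f0 x - f1 x * (t - x) - f2 x * ((t - x)^2 / 2))
    (F' := fun t => f1 t - f1 x - f2 x * (t - x)) hx
    (fun t ht => ?_) hK 2 (by simpa using a1) (by simp)
  have e := (((h0 t ht).sub_const (f0 x)).sub
    (((hasDerivWithinAt_id t (Icc p q)).sub_const x).const_mul (f1 x))).sub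
    (((((hasDerivWithinAt_id t (Icc p q)).sub_const x).pow 2).div_const 2).const_mul (f2 x))
  refine e.congr_deriv ?_
  simp

lemma tay4 {p q x : ℝ} {f0 f1 f2 f3 f4 : ℝ → ℝ} (hx : x ∈ Icc p q)
    (h0 : DvOn p q f0 f1) (h1 : DvOn p q f1 f2) (h2 : DvOn p q f2 f3) (h3 : DvOn p q f3 f4)
    {K : ℝ} (hK : 0 ≤ K)
    (hb : ∀ t ∈ Icc p q, |f4 t| ≤ K) :
    ∀ t ∈ Icc p q, |f0 t - f0 x - f1 x * (t - x) - f2 x * ((t - x)^2 / 2)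
      - f3 x * ((t - x)^3 / 6)| ≤ K * |t - x| ^ 4 := by
  have a1 := tay3 hx h1 h2 h3 hK hb
  refine tay_step (F := fun t => f0 t - f0 x - f1 x * (t - x) - f2 x * ((t - x)^2 / 2)
      - f3 x * ((t - x)^3 / 6))
    (F' := fun t => f1 t - f1 x - f2 x * (t - x) - f3 x * ((t - x)^2 / 2)) hx
    (fun t ht => ?_) hK 3 (by simpa using a1) (by simp)
  have e := ((((h0 t ht).sub_const (f0 x)).sub
    (((hasDerivWithinAt_id t (Icc p q)).sub_const x).const_mul (f1 x))).sub
    (((((hasDerivWithinAt_id t (Icc p q)).sub_const x).pow 2).div_const 2).const_mul (f2 x))).sub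
    (((((hasDerivWithinAt_id t (Icc p q)).sub_const x).pow 3).div_const 6).const_mul (f3 x))
  refine e.congr_deriv ?_
  simp
  left
  ring

/-- second divided difference on `x-h, x, x+k` -/
def dd (h k a c d : ℝ) : ℝ := 2 / (h + k) * ((d - c) / k - (c - a) / h)

lemma dd_rem {h k a c d s A B P Q : ℝ} (hh : 0 < h) (hk : 0 < k)
    (hd : |d - c - s * k - P * k| ≤ A * k) (ha : |a - c + s * h - Q * h| ≤ B * h) :
    |dd h k a c d - 2 / (h + k) * (P + Q)| ≤ 2 / (h + k) * (A + B) := by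
  have e : dd h k a c d - 2 / (h + k) * (P + Q)
      = 2 / (h + k) * ((d - c - s * k - P * k) / k + (a - c + s * h - Q * h) / h) := by
    unfold dd
    field_simp
    ring
  rw [e, abs_mul, abs_of_pos (by positivity : 0 < 2 / (h + k))]
  gcongr
  refine (abs_add_le _ _).trans ?_
  rw [abs_div, abs_div, abs_of_pos hh, abs_of_pos hk]
  gcongr
  · rwa [div_le_iff₀ hk]
  · rwa [div_le_iff₀ hh]

lemma trunc2 {x h k : ℝ} {f0 f1 f2 : ℝ → ℝ} (hh : 0 < h) (hk : 0 < k)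
    (h0 : DvOn (x-h) (x+k) f0 f1) (h1 : DvOn (x-h) (x+k) f1 f2) {K : ℝ}
    (hb : ∀ t ∈ Icc (x-h) (x+k), |f2 t| ≤ K) :
    |dd h k (f0 (x-h)) (f0 x) (f0 (x+k)) - f2 x| ≤ 3 * K := by
  have hx : x ∈ Icc (x-h) (x+k) := ⟨by linarith, by linarith⟩
  have hK : 0 ≤ K := (abs_nonneg _).trans (hb x hx)
  have T := tay2 hx h0 h1 hK hb
  have t1 := T (x+k) ⟨by linarith, le_refl _⟩
  have t2 := T (x-h) ⟨le_refl _, by linarith⟩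
  have e1 : x + k - x = k := by ring
  have e2 : x - h - x = -h := by ring
  rw [e1, abs_of_pos hk] at t1
  rw [e2, abs_neg, abs_of_pos hh] at t2
  have R := dd_rem (h := h) (k := k) (a := f0 (x-h)) (c := f0 x) (d := f0 (x+k)) (s := f1 x)
    (A := K * k) (B := K * h) (P := 0) (Q := 0) hh hk
    (by convert t1 using 1 <;> ring_nf) (by convert t2 using 1 <;> ring_nf)
  have : 2 / (h + k) * (K * k + K * h) = 2 * K := by field_simp; ring
  rw [this] at R
  have := hb x hx
  rw [abs_le] at *
  constructor <;> linarith [R.1, R.2, this.1, this.2]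

lemma trunc3 {x h k : ℝ} {f0 f1 f2 f3 : ℝ → ℝ} (hh : 0 < h) (hk : 0 < k)
    (h0 : DvOn (x-h) (x+k) f0 f1) (h1 : DvOn (x-h) (x+k) f1 f2)
    (h2 : DvOn (x-h) (x+k) f2 f3) {K : ℝ}
    (hb : ∀ t ∈ Icc (x-h) (x+k), |f3 t| ≤ K) :
    |dd h k (f0 (x-h)) (f0 x) (f0 (x+k)) - f2 x| ≤ 2 * (h + k) * K := by
  have hx : x ∈ Icc (x-h) (x+k) := ⟨by linarith, by linarith⟩
  have hK : 0 ≤ K := (abs_nonneg _).trans (hb x hx)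
  have T := tay3 hx h0 h1 h2 hK hb
  have t1 := T (x+k) ⟨by linarith, le_refl _⟩
  have t2 := T (x-h) ⟨le_refl _, by linarith⟩
  have e1 : x + k - x = k := by ring
  have e2 : x - h - x = -h := by ring
  rw [e1, abs_of_pos hk] at t1
  rw [e2, abs_neg, abs_of_pos hh] at t2
  have R := dd_rem (h := h) (k := k) (a := f0 (x-h)) (c := f0 x) (d := f0 (x+k)) (s := f1 x)
    (A := K * k^2) (B := K * h^2) (P := f2 x * (k/2)) (Q := f2 x * (h/2)) hh hk
    (by convert t1 using 1 <;> ring_nf) (by convert t2 using 1 <;> ring_nf)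
  have e3 : 2 / (h + k) * (f2 x * (k/2) + f2 x * (h/2)) = f2 x := by field_simp; ring
  rw [e3] at R
  refine R.trans ?_
  rw [div_mul_eq_mul_div, div_le_iff₀ (by positivity)]
  nlinarith [mul_nonneg hK (mul_pos hh hk).le]

lemma trunc4 {x h : ℝ} {f0 f1 f2 f3 f4 : ℝ → ℝ} (hh : 0 < h)
    (h0 : DvOn (x-h) (x+h) f0 f1) (h1 : DvOn (x-h) (x+h) f1 f2)
    (h2 : DvOn (x-h) (x+h) f2 f3) (h3 : DvOn (x-h) (x+h) f3 f4) {K : ℝ}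
    (hb : ∀ t ∈ Icc (x-h) (x+h), |f4 t| ≤ K) :
    |dd h h (f0 (x-h)) (f0 x) (f0 (x+h)) - f2 x| ≤ 2 * h^2 * K := by
  have hx : x ∈ Icc (x-h) (x+h) := ⟨by linarith, by linarith⟩
  have hK : 0 ≤ K := (abs_nonneg _).trans (hb x hx)
  have T := tay4 hx h0 h1 h2 h3 hK hb
  have t1 := T (x+h) ⟨by linarith, le_refl _⟩
  have t2 := T (x-h) ⟨le_refl _, by linarith⟩
  have e1 : x + h - x = h := by ring
  have e2 : x - h - x = -h := by ring
  rw [e1, abs_of_pos hh] at t1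
  rw [e2, abs_neg, abs_of_pos hh] at t2
  have R := dd_rem (h := h) (k := h) (a := f0 (x-h)) (c := f0 x) (d := f0 (x+h)) (s := f1 x)
    (A := K * h^3) (B := K * h^3) (P := f2 x * (h/2) + f3 x * (h^2/6))
    (Q := f2 x * (h/2) - f3 x * (h^2/6)) hh hh
    (by convert t1 using 1 <;> ring_nf) (by convert t2 using 1 <;> ring_nf)
  have e3 : 2 / (h + h) * (f2 x * (h/2) + f3 x * (h^2/6) + (f2 x * (h/2) - f3 x * (h^2/6)))
      = f2 x := by field_simp; ring
  rw [e3] at R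
  refine R.trans (le_of_eq ?_)
  field_simp

/-- second derivative at an interior minimum -/
lemma second_deriv_min {φ φ1 φ2 : ℝ → ℝ} (h0 : DvOn 0 1 φ φ1) (h1 : DvOn 0 1 φ1 φ2)
    {c : ℝ} (hc : c ∈ Ioo (0:ℝ) 1) (hmin : ∀ t ∈ Icc (0:ℝ) 1, φ c ≤ φ t) : 0 ≤ φ2 c := by
  by_contra hneg
  push Not at hneg
  have hn : ∀ t ∈ Ioo (0:ℝ) 1, Icc (0:ℝ) 1 ∈ nhds t := fun t ht => Icc_mem_nhds ht.1 ht.2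
  have d0 : ∀ t ∈ Ioo (0:ℝ) 1, HasDerivAt φ (φ1 t) t := fun t ht =>
    (h0 t (Ioo_subset_Icc_self ht)).hasDerivAt (hn t ht)
  have ev : deriv φ =ᶠ[nhds c] φ1 := by
    filter_upwards [Ioo_mem_nhds hc.1 hc.2] with t ht using (d0 t ht).deriv
  have d2 : deriv (deriv φ) c = φ2 c := by
    rw [ev.deriv_eq]
    exact ((h1 c (Ioo_subset_Icc_self hc)).hasDerivAt (hn c hc)).deriv
  have lmin : IsLocalMin φ c := by
    filter_upwards [hn c hc] with t ht using hmin t ht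
  have lmax : IsLocalMax φ c := by
    refine isLocalMax_of_deriv_deriv_neg (by rw [d2]; exact hneg) lmin.deriv_eq_zero
      (d0 c hc).continuousAt
  have cst : φ =ᶠ[nhds c] fun _ => φ c := by
    filter_upwards [lmin, lmax] with t h1 h2 using le_antisymm h2 h1
  have : deriv (deriv φ) c = 0 := by
    rw [(cst.deriv).deriv_eq]; simp
  rw [this] at d2
  linarith

/-- continuous maximum principle -/
lemma cont_max {φ φ1 φ2 b : ℝ → ℝ} {ε : ℝ} (h0 : DvOn 0 1 φ φ1) (h1 : DvOn 0 1 φ1 φ2)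
    (hb : ∀ t ∈ Icc (0:ℝ) 1, 0 < b t)
    (hL : ∀ t ∈ Ioo (0:ℝ) 1, 0 ≤ -ε^2 * φ2 t + b t * φ t) (hl : 0 ≤ φ 0) (hr : 0 ≤ φ 1) :
    ∀ t ∈ Icc (0:ℝ) 1, 0 ≤ φ t := by
  have hc : ContinuousOn φ (Icc 0 1) := fun t ht => (h0 t ht).continuousWithinAt
  obtain ⟨c, hcI, hmin⟩ := isCompact_Icc.exists_isMinOn (nonempty_Icc.2 zero_le_one) hc
  have hmin' : ∀ t ∈ Icc (0:ℝ) 1, φ c ≤ φ t := fun t ht => hmin ht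
  intro t ht
  refine le_trans ?_ (hmin' t ht)
  by_contra hneg
  push Not at hneg
  have hco : c ∈ Ioo (0:ℝ) 1 := by
    refine ⟨lt_of_le_of_ne hcI.1 ?_, lt_of_le_of_ne hcI.2 ?_⟩
    · rintro rfl; linarith
    · rintro rfl; linarith
  have s := second_deriv_min h0 h1 hco hmin'
  have := hL c hco
  have b1 := hb c hcI
  nlinarith [mul_nonneg (sq_nonneg ε) s, mul_pos_of_neg_of_neg hneg (neg_lt_zero.2 b1)]

/-- the layer function -/
def lay (γ ε x : ℝ) : ℝ := Real.exp (-γ * x / ε) + Real.exp (-γ * (1 - x) / ε)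

lemma lay_pos (γ ε x : ℝ) : 0 < lay γ ε x := by unfold lay; positivity

lemma lay_le {γ ε a b : ℝ} (hγ : 0 < γ) (hε : 0 < ε) {x : ℝ} (h1 : a ≤ x) (h2 : x ≤ 1 - b) :
    lay γ ε x ≤ Real.exp (-γ * a / ε) + Real.exp (-γ * b / ε) := by
  unfold lay
  apply add_le_add
  · apply Real.exp_le_exp.2
    gcongr ?_ / _
    nlinarith
  · apply Real.exp_le_exp.2
    gcongr ?_ / _
    nlinarith

lemma lay_le_two {γ ε x : ℝ} (hγ : 0 < γ) (hε : 0 < ε) (hx : x ∈ Icc (0:ℝ) 1) :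
    lay γ ε x ≤ 2 := by
  have := lay_le (a := 0) (b := 0) hγ hε hx.1 (by linarith [hx.2] : x ≤ 1 - 0)
  norm_num at this
  linarith

lemma lay_near {γ ε x t : ℝ} (hγ : 0 < γ) (hγ1 : γ ≤ 1) (hε : 0 < ε) (h : |t - x| ≤ ε) :
    lay γ ε t ≤ 3 * lay γ ε x := by
  rw [abs_le] at h
  have e3 : Real.exp 1 ≤ 3 := by linarith [Real.exp_one_lt_d9]
  have : ∀ y : ℝ, ∀ z : ℝ, y - z ≤ 1 → Real.exp y ≤ 3 * Real.exp z := by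
    intro y z hyz
    calc Real.exp y ≤ Real.exp (1 + z) := Real.exp_le_exp.2 (by linarith)
      _ = Real.exp 1 * Real.exp z := Real.exp_add _ _
      _ ≤ 3 * Real.exp z := by gcongr
  unfold lay
  rw [mul_add]
  apply add_le_add
  · apply this
    rw [← sub_div, div_le_one hε]
    nlinarith
  · apply this
    rw [← sub_div, div_le_one hε]
    nlinarith

lemma dv_lay (γ ε : ℝ) : DvOn 0 1 (lay γ ε)
    (fun x => -γ/ε * Real.exp (-γ * x / ε) + γ/ε * Real.exp (-γ * (1 - x) / ε)) := by
  intro t _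
  apply HasDerivAt.hasDerivWithinAt
  have a1 : HasDerivAt (fun x : ℝ => -γ * x / ε) (-γ/ε) t := by
    simpa using ((hasDerivAt_id t).const_mul (-γ)).div_const ε
  have a2 : HasDerivAt (fun x : ℝ => -γ * (1 - x) / ε) (γ/ε) t := by
    simpa using (((hasDerivAt_id t).const_sub 1).const_mul (-γ)).div_const ε
  refine (a1.exp.add a2.exp).congr_deriv ?_
  ring

lemma dv_lay' (γ ε : ℝ) : DvOn 0 1 
    (fun x => -γ/ε * Real.exp (-γ * x / ε) + γ/ε * Real.exp (-γ * (1 - x) / ε))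
    (fun x => (γ/ε)^2 * lay γ ε x) := by
  intro t _
  apply HasDerivAt.hasDerivWithinAt
  have a1 : HasDerivAt (fun x : ℝ => -γ * x / ε) (-γ/ε) t := by
    simpa using ((hasDerivAt_id t).const_mul (-γ)).div_const ε
  have a2 : HasDerivAt (fun x : ℝ => -γ * (1 - x) / ε) (γ/ε) t := by
    simpa using (((hasDerivAt_id t).const_sub 1).const_mul (-γ)).div_const ε
  refine ((a1.exp.const_mul (-γ/ε)).add (a2.exp.const_mul (γ/ε))).congr_deriv ?_
  unfold lay
  ring

/-- one-sided layer bound -/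
lemma z_bound_aux {γ ε β K s : ℝ} {z0 z1 z2 b ρ : ℝ → ℝ} (hγ : 0 < γ) (hγβ : γ^2 ≤ β)
    (hε : 0 < ε) (hs : s = 1 ∨ s = -1)
    (h0 : DvOn 0 1 z0 z1) (h1 : DvOn 0 1 z1 z2) (hb : ∀ t ∈ Icc (0:ℝ) 1, β ≤ b t)
    (hK : 0 ≤ K)
    (hz : ∀ t ∈ Ioo (0:ℝ) 1, -ε^2 * z2 t + b t * z0 t = ε^2 * ρ t)
    (hρ : ∀ t ∈ Icc (0:ℝ) 1, |ρ t| ≤ β * K) (hl : |z0 0| ≤ K) (hr : |z0 1| ≤ K) :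
    ∀ t ∈ Icc (0:ℝ) 1, 0 ≤ K * ε^2 + K * lay γ ε t + s * z0 t := by
  have hβ : 0 < β := lt_of_lt_of_le (by positivity) hγβ
  refine cont_max (φ := fun t => K * ε^2 + K * lay γ ε t + s * z0 t)
    (φ1 := fun t => K * (-γ/ε * Real.exp (-γ * t / ε) + γ/ε * Real.exp (-γ * (1 - t) / ε))
      + s * z1 t)
    (φ2 := fun t => K * ((γ/ε)^2 * lay γ ε t) + s * z2 t) (b := b) (ε := ε) ?_ ?_ 
    (fun t ht => lt_of_lt_of_le hβ (hb t ht)) ?_ ?_ ?_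
  · intro t ht
    exact (((dv_lay γ ε t ht).const_mul K).const_add _).add ((h0 t ht).const_mul s)
  · intro t ht
    exact ((dv_lay' γ ε t ht).const_mul K).add ((h1 t ht).const_mul s)
  · intro t ht
    have htI := Ioo_subset_Icc_self ht
    have e1 := hz t ht
    have e2 := hρ t htI
    have e3 := hb t htI
    have e4 := lay_pos γ ε t
    have e5 : -ε^2 * (K * ((γ/ε)^2 * lay γ ε t) + s * z2 t)
        + b t * (K * ε^2 + K * lay γ ε t + s * z0 t)
        = (b t - γ^2) * (K * lay γ ε t) + ε^2 * (b t * K + s * ρ t) := by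
      have : -ε^2 * (K * ((γ/ε)^2 * lay γ ε t)) = - γ^2 * (K * lay γ ε t) := by
        field_simp
      linear_combination this + s * e1
    rw [e5]
    have e6 : 0 ≤ b t * K + s * ρ t := by
      have : β * K ≤ b t * K := by gcongr
      rw [abs_le] at e2
      rcases hs with rfl | rfl <;> linarith [e2.1, e2.2]
    have e7 : 0 ≤ b t - γ^2 := by linarith
    positivity
  · have : 1 ≤ lay γ ε 0 := by unfold lay; simp; positivity
    rw [abs_le] at hl
    have h3 : 0 ≤ K * ε^2 := by positivity
    have h4 : K ≤ K * lay γ ε 0 := le_mul_of_one_le_right hK this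
    rcases hs with rfl | rfl <;> linarith [hl.1, hl.2]
  · have : 1 ≤ lay γ ε 1 := by unfold lay; simp; positivity
    rw [abs_le] at hr
    have h3 : 0 ≤ K * ε^2 := by positivity
    have h4 : K ≤ K * lay γ ε 1 := le_mul_of_one_le_right hK this
    rcases hs with rfl | rfl <;> linarith [hr.1, hr.2]

lemma z_bound {γ ε β K : ℝ} {z0 z1 z2 b ρ : ℝ → ℝ} (hγ : 0 < γ) (hγβ : γ^2 ≤ β)
    (hε : 0 < ε)
    (h0 : DvOn 0 1 z0 z1) (h1 : DvOn 0 1 z1 z2) (hb : ∀ t ∈ Icc (0:ℝ) 1, β ≤ b t)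
    (hK : 0 ≤ K)
    (hz : ∀ t ∈ Ioo (0:ℝ) 1, -ε^2 * z2 t + b t * z0 t = ε^2 * ρ t)
    (hρ : ∀ t ∈ Icc (0:ℝ) 1, |ρ t| ≤ β * K) (hl : |z0 0| ≤ K) (hr : |z0 1| ≤ K) :
    ∀ t ∈ Icc (0:ℝ) 1, |z0 t| ≤ K * (ε^2 + lay γ ε t) := by
  intro t ht
  have a1 := z_bound_aux hγ hγβ hε (Or.inl rfl) h0 h1 hb hK hz hρ hl hr t ht
  have a2 := z_bound_aux hγ hγβ hε (Or.inr rfl) h0 h1 hb hK hz hρ hl hr t ht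
  rw [abs_le]
  constructor <;> linarith

/-- first-derivative bound by interpolation -/
lemma z1_bound {γ ε K L : ℝ} {z0 z1 z2 : ℝ → ℝ} (hγ : 0 < γ) (hγ1 : γ ≤ 1)
    (hε : 0 < ε) (hε1 : ε ≤ 1)
    (h0 : DvOn 0 1 z0 z1) (h1 : DvOn 0 1 z1 z2) (hK : 0 ≤ K) (hL : 0 ≤ L)
    (b0 : ∀ t ∈ Icc (0:ℝ) 1, |z0 t| ≤ K * (ε^2 + lay γ ε t))
    (b2 : ∀ t ∈ Icc (0:ℝ) 1, ε^2 * |z2 t| ≤ L * (ε^2 + lay γ ε t)) :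
    ∀ t ∈ Icc (0:ℝ) 1, ε * |z1 t| ≤ (8 * K + 2 * L) * (ε^2 + lay γ ε t) := by
  intro x hx
  obtain ⟨p, hp0, hp1, hxp, t, ht, htx⟩ : ∃ p : ℝ, 0 ≤ p ∧ p + ε/2 ≤ 1 ∧
      x ∈ Icc p (p + ε/2) ∧ ∃ t ∈ Icc p (p+ε/2), |t - x| = ε/2 := by
    rcases le_total x (1/2) with h | h
    · refine ⟨x, hx.1, by linarith, ⟨le_refl _, by linarith⟩, x + ε/2, ⟨by linarith, le_refl _⟩, ?_⟩
      rw [add_sub_cancel_left, abs_of_pos (by positivity)]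
    · refine ⟨x - ε/2, by linarith, by linarith [hx.2], ⟨by linarith, by linarith⟩, x - ε/2, 
        ⟨le_refl _, by linarith⟩, ?_⟩
      rw [sub_sub_cancel_left, abs_neg, abs_of_pos (by positivity)]
  have hlp := lay_pos γ ε x
  set S := ε^2 + lay γ ε x with hS
  have near : ∀ s ∈ Icc p (p+ε/2), ε^2 + lay γ ε s ≤ 3 * S := by
    intro s hs
    have := lay_near (x := x) (t := s) hγ hγ1 hε (by
      rw [abs_le]; constructor <;> linarith [hs.1, hs.2, hxp.1, hxp.2])
    nlinarith [sq_nonneg ε]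
  have sub : ∀ s ∈ Icc p (p+ε/2), s ∈ Icc (0:ℝ) 1 := fun s hs =>
    ⟨hp0.trans hs.1, hs.2.trans hp1⟩
  have hSp : 0 < S := by positivity
  have T := tay2 (K := 3 * L * S / ε^2) hxp (h0.mono hp0 hp1) (h1.mono hp0 hp1) (by positivity) (by
    intro s hs
    rw [le_div_iff₀ (by positivity), mul_comm]
    refine (b2 s (sub s hs)).trans ?_
    calc L * (ε^2 + lay γ ε s) ≤ L * (3 * S) := by gcongr; exact near s hs
      _ = _ := by ring) t ht
  rw [htx] at T
  have e : 3 * L * S / ε^2 * (ε/2)^2 = 3/4 * L * S := by field_simp; norm_num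
  rw [e] at T
  have c1 : |z0 t| ≤ K * (3 * S) := (b0 t (sub t ht)).trans (by gcongr; exact near t ht)
  have c2 : |z0 x| ≤ K * S := b0 x hx
  have c3 : |z1 x| * (ε/2) ≤ 4 * K * S + 3/4 * L * S := by
    rw [← htx, ← abs_mul]
    rw [abs_le] at *
    constructor <;> linarith [T.1, T.2, c1.1, c1.2, c2.1, c2.2]
  have : 0 ≤ L * S := by positivity
  linarith

/-- A-priori derivative bounds for the solution. -/
lemma apriori {γ ε β K M : ℝ} {u0 u1 b0 b1 b2 r0 r1 r2 : ℝ → ℝ} (hγ : 0 < γ) (hγ1 : γ ≤ 1)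
    (hγβ : γ^2 ≤ β) (hε : 0 < ε) (hε1 : ε ≤ 1)
    (hu0 : DvOn 0 1 u0 u1) (hu1 : DvOn 0 1 u1 (fun t => b0 t * (u0 t - r0 t) / ε^2))
    (hb0 : DvOn 0 1 b0 b1) (hb1 : DvOn 0 1 b1 b2)
    (hr0 : DvOn 0 1 r0 r1) (hr1 : DvOn 0 1 r1 r2)
    (hM : 0 ≤ M) (hK : 0 ≤ K)
    (hbβ : ∀ t ∈ Icc (0:ℝ) 1, β ≤ b0 t)
    (Mb0 : ∀ t ∈ Icc (0:ℝ) 1, |b0 t| ≤ M) (Mb1 : ∀ t ∈ Icc (0:ℝ) 1, |b1 t| ≤ M)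
    (Mb2 : ∀ t ∈ Icc (0:ℝ) 1, |b2 t| ≤ M)
    (Kr0 : ∀ t ∈ Icc (0:ℝ) 1, |r0 t| ≤ K)
    (Kr2 : ∀ t ∈ Icc (0:ℝ) 1, |r2 t| ≤ β * K)
    (hl : u0 0 = 0) (hr : u0 1 = 0) :
    ∃ u3 u4 : ℝ → ℝ, DvOn 0 1 (fun t => b0 t * (u0 t - r0 t) / ε^2) u3 ∧ DvOn 0 1 u3 u4 ∧
      ∀ t ∈ Icc (0:ℝ) 1,
       ε^2 * |b0 t * (u0 t - r0 t) / ε^2| ≤ (M * (50 * K + 10 * (M*K+β*K))) * (ε^2 + lay γ ε t) ∧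
       ε^3 * |u3 t| ≤ (M * (50 * K + 10 * (M*K+β*K))) * (ε^2 + lay γ ε t) ∧
       ε^4 * |u4 t| ≤ (M * (50 * K + 10 * (M*K+β*K))) * (ε^2 + lay γ ε t) := by
  have hβ : 0 < β := lt_of_lt_of_le (by positivity) hγβ
  have hz0 : DvOn 0 1 (fun t => u0 t - r0 t) (fun t => u1 t - r1 t) := 
    fun t ht => (hu0 t ht).sub (hr0 t ht)
  have hz1 : DvOn 0 1 (fun t => u1 t - r1 t) (fun t => b0 t * (u0 t - r0 t) / ε^2 - r2 t) := 
    fun t ht => (hu1 t ht).sub (hr1 t ht)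
  have B0 := z_bound (z0 := fun t => u0 t - r0 t) (K := K) (b := b0) (ρ := r2) hγ hγβ hε hz0 hz1 hbβ hK
    (fun t ht => by field_simp; ring) Kr2
    (by simpa [hl] using Kr0 0 (by simp)) (by simpa [hr] using Kr0 1 (by simp))
  have B2 : ∀ t ∈ Icc (0:ℝ) 1, ε^2 * |b0 t * (u0 t - r0 t) / ε^2 - r2 t|
      ≤ (M * K + β * K) * (ε^2 + lay γ ε t) := by
    intro t ht
    have e1 := B0 t ht
    have e2 := Mb0 t ht
    have e3 := Kr2 t ht
    have hp := lay_pos γ ε t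
    calc ε^2 * |b0 t * (u0 t - r0 t) / ε^2 - r2 t| 
        = |b0 t * (u0 t - r0 t) - ε^2 * r2 t| := by
          rw [← abs_of_pos (by positivity : 0 < ε^2), ← abs_mul, abs_of_pos (by positivity : 0 < ε^2)]
          congr 1; field_simp
      _ ≤ |b0 t| * |u0 t - r0 t| + ε^2 * |r2 t| := by
          refine (abs_sub _ _).trans ?_
          rw [abs_mul, abs_mul, abs_of_pos (by positivity : 0 < ε^2)]
      _ ≤ M * (K * (ε^2 + lay γ ε t)) + ε^2 * (β * K) := by gcongr
      _ ≤ _ := by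
          have : 0 ≤ β * K * lay γ ε t := by positivity
          linarith
  have hL : 0 ≤ M * K + β * K := by positivity
  have B1 := z1_bound hγ hγ1 hε hε1 hz0 hz1 hK hL B0 B2
  refine ⟨fun t => (b1 t * (u0 t - r0 t) + b0 t * (u1 t - r1 t)) / ε^2,
    fun t => ((b2 t * (u0 t - r0 t) + b1 t * (u1 t - r1 t)) + (b1 t * (u1 t - r1 t)
      + b0 t * (b0 t * (u0 t - r0 t) / ε^2 - r2 t))) / ε^2, ?_, ?_, ?_⟩
  · intro t ht
    exact ((hb0 t ht).mul (hz0 t ht)).div_const _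
  · intro t ht
    exact (((hb1 t ht).mul (hz0 t ht)).add ((hb0 t ht).mul (hz1 t ht))).div_const _
  intro t ht
  have e0 := B0 t ht
  have e1 := B1 t ht
  have e2 := B2 t ht
  have m0 := Mb0 t ht
  have m1 := Mb1 t ht
  have m2 := Mb2 t ht
  have hp := lay_pos γ ε t
  beta_reduce at e0 e1 e2 ⊢
  generalize b0 t * (u0 t - r0 t) / ε^2 - r2 t = Z2 at *
  generalize u0 t - r0 t = Z0 at *
  generalize u1 t - r1 t = Z1 at *
  generalize M * K + β * K = L at *
  set S := ε^2 + lay γ ε t with hS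
  have hSp : 0 < S := by positivity
  have hLS : 0 ≤ M * (L * S) := by positivity
  have hKS : 0 ≤ M * (K * S) := by positivity
  have p0 : ∀ c : ℝ, |c| ≤ M → |c * Z0| ≤ M * (K * S) := by
    intro c hc; rw [abs_mul]; gcongr
  have p1 : ∀ c : ℝ, |c| ≤ M → ε * |c * Z1| ≤ M * ((8 * K + 2 * L) * S) := by
    intro c hc
    rw [abs_mul, mul_left_comm]; gcongr
  have p2 : ∀ c : ℝ, |c| ≤ M → ε^2 * |c * Z2| ≤ M * (L * S) := by
    intro c hc
    rw [abs_mul, mul_left_comm]; gcongr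
  have hε2 : ε^2 ≤ 1 := pow_le_one₀ hε.le hε1
  refine ⟨?_, ?_, ?_⟩
  · rw [abs_div, abs_of_pos (by positivity : 0 < ε^2), mul_div_cancel₀ _ (by positivity)]
    nlinarith [p0 _ m0]
  · rw [abs_div, abs_of_pos (by positivity : 0 < ε^2)]
    have : ε^3 * (|b1 t * Z0 + b0 t * Z1| / ε^2) = ε * |b1 t * Z0 + b0 t * Z1| := by
      field_simp
    rw [this]
    have q0 : ε * |b1 t * Z0| ≤ M * (K * S) := 
      (mul_le_of_le_one_left (abs_nonneg _) hε1).trans (p0 _ m1)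
    have q1 := p1 _ m0
    have := mul_le_mul_of_nonneg_left (abs_add_le (b1 t * Z0) (b0 t * Z1)) hε.le
    linarith
  · rw [abs_div, abs_of_pos (by positivity : 0 < ε^2)]
    have : ∀ X : ℝ, ε^4 * (X / ε^2) = ε^2 * X := by intro X; field_simp
    rw [this]
    have q0 : ε^2 * |b2 t * Z0| ≤ M * (K * S) := 
      (mul_le_of_le_one_left (abs_nonneg _) hε2).trans (p0 _ m2)
    have q1 : ε^2 * |b1 t * Z1| ≤ M * ((8 * K + 2 * L) * S) := by
      refine le_trans ?_ (p1 _ m1)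
      gcongr
      nlinarith
    have q2 := p2 _ m0
    have a := mul_le_mul_of_nonneg_left (abs_add_le (b2 t * Z0 + b1 t * Z1) (b1 t * Z1 + b0 t * Z2)) (sq_nonneg ε)
    have a' := mul_le_mul_of_nonneg_left (abs_add_le (b2 t * Z0) (b1 t * Z1)) (sq_nonneg ε)
    have a'' := mul_le_mul_of_nonneg_left (abs_add_le (b1 t * Z1) (b0 t * Z2)) (sq_nonneg ε)
    linarith

lemma ddiff_eq_dd {x y : ℕ → ℝ} {i : ℕ} {h k : ℝ} (h1 : x (i-1) = x i - h) (h2 : x (i+1) = x i + k) :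
    ddiff x y i = dd h k (y (i-1)) (y i) (y (i+1)) := by
  unfold ddiff dd
  have e1 : x i + k - (x i - h) = h + k := by ring
  have e2 : x i + k - x i = k := by ring
  have e3 : x i - (x i - h) = h := by ring
  rw [h1, h2, e1, e2, e3]

/-- discrete maximum principle -/
lemma disc_max {x φ c : ℕ → ℝ} {n : ℕ} {ε : ℝ} (hx : ∀ i < n, x i < x (i+1))
    (hc : ∀ i, 1 ≤ i → i < n → 0 < c i)
    (hL : ∀ i, 1 ≤ i → i < n → 0 ≤ -ε^2 * ddiff x φ i + c i * φ i)
    (h0 : 0 ≤ φ 0) (hn : 0 ≤ φ n) : ∀ i ≤ n, 0 ≤ φ i := by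
  obtain ⟨j, hj, hmin⟩ := Finset.exists_min_image (Finset.range (n+1)) φ ⟨0, by simp⟩
  intro i hi
  refine le_trans ?_ (hmin i (by simp; omega))
  by_contra hneg
  push Not at hneg
  have hjn : j ≤ n := by simp at hj; omega
  have j0 : j ≠ 0 := by rintro rfl; linarith
  have j1 : j ≠ n := by rintro rfl; linarith
  have L := hL j (by omega) (by omega)
  have cp := hc j (by omega) (by omega)
  have m1 := hmin (j+1) (by simp; omega)
  have m2 := hmin (j-1) (by simp; omega)
  have x1 := hx j (by omega)
  have x2 := hx (j-1) (by omega)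
  have e : j - 1 + 1 = j := by omega
  rw [e] at x2
  have d : 0 ≤ ddiff x φ j := by
    unfold ddiff
    apply mul_nonneg
    · apply div_nonneg (by norm_num); linarith
    · have : 0 ≤ (φ (j+1) - φ j) / (x (j+1) - x j) := div_nonneg (by linarith) (by linarith)
      have : (φ j - φ (j-1)) / (x j - x (j-1)) ≤ 0 := div_nonpos_of_nonpos_of_nonneg (by linarith) (by linarith)
      linarith
  nlinarith [mul_nonneg (sq_nonneg ε) d, mul_pos_of_neg_of_neg hneg (neg_lt_zero.2 cp)]

lemma ddiff_lin (x y y' : ℕ → ℝ) (a c : ℝ) (i : ℕ) :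
    ddiff x (fun j => a * y j + c * y' j) i = a * ddiff x y i + c * ddiff x y' i := by
  unfold ddiff; ring

lemma ddiff_congr {x y y' : ℕ → ℝ} {n i : ℕ} (h : ∀ j ≤ n, y j = y' j) (hi : i < n) :
    ddiff x y i = ddiff x y' i := by
  unfold ddiff
  rw [h i hi.le, h (i+1) hi, h (i-1) (by omega)]

lemma disc_unique {bc gc : ℝ → ℝ} {x : ℕ → ℝ} {n : ℕ} {ε : ℝ} (hx : ∀ i < n, x i < x (i+1))
    (hc : ∀ i, 1 ≤ i → i < n → 0 < bc (x i)) {y y' : ℕ → ℝ}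
    (hy : LinScheme bc gc ε x n y) (hy' : LinScheme bc gc ε x n y') : ∀ i ≤ n, y i = y' i := by
  have key : ∀ {y y' : ℕ → ℝ}, LinScheme bc gc ε x n y → LinScheme bc gc ε x n y' →
      ∀ i ≤ n, y' i ≤ y i := by
    intro y y' hy hy' i hi
    have := disc_max (φ := fun j => 1 * y j + (-1) * y' j) (c := fun i => bc (x i)) (ε := ε) hx hc
      (by
        intro i h1 h2
        rw [ddiff_lin]
        have a1 := hy.1 i h1 h2
        have a2 := hy'.1 i h1 h2
        linarith) (by rw [hy.2.1, hy'.2.1]; norm_num) (by rw [hy.2.2, hy'.2.2]; norm_num) i hi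
    linarith
  intro i hi
  exact le_antisymm (key hy' hy i hi) (key hy hy' i hi)

/-- extension of a finite vector by zero -/
def extZ (n : ℕ) (v : Fin (n+1) → ℝ) (i : ℕ) : ℝ := if h : i < n+1 then v ⟨i, h⟩ else 0

lemma disc_exists {bc gc : ℝ → ℝ} {x : ℕ → ℝ} {n : ℕ} {ε : ℝ} (hn : 1 ≤ n)
    (hx : ∀ i < n, x i < x (i+1))
    (hc : ∀ i, 1 ≤ i → i < n → 0 < bc (x i)) : ∃ y, LinScheme bc gc ε x n y := by
  classical
  have extlin : ∀ (a c : ℝ) (v w : Fin (n+1) → ℝ), extZ n (a • v + c • w)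
      = fun j => a * extZ n v j + c * extZ n w j := by
    intro a c v w
    funext j
    unfold extZ
    split_ifs <;> simp
  let T0 : (Fin (n+1) → ℝ) → (Fin (n+1) → ℝ) := fun v i =>
    if (i:ℕ) = 0 ∨ (i:ℕ) = n then extZ n v i
    else -ε^2 * ddiff x (extZ n v) i + bc (x i) * extZ n v i
  have T0lin : ∀ (a c : ℝ) (v w : Fin (n+1) → ℝ), T0 (a • v + c • w) = a • T0 v + c • T0 w := by
    intro a c v w
    funext i
    simp only [T0, extlin, ddiff_lin, Pi.add_apply, Pi.smul_apply, smul_eq_mul]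
    split_ifs <;> ring
  let T : (Fin (n+1) → ℝ) →ₗ[ℝ] (Fin (n+1) → ℝ) :=
    { toFun := T0
      map_add' := fun v w => by simpa using T0lin 1 1 v w
      map_smul' := fun a v => by simpa using T0lin a 0 v 0 }
  have inj : Function.Injective T := by
    rw [← LinearMap.ker_eq_bot, LinearMap.ker_eq_bot']
    intro v hv
    have hv' : ∀ i, T0 v i = 0 := fun i => congrFun hv i
    have s1 : LinScheme bc (fun _ => 0) ε x n (extZ n v) := by
      refine ⟨fun i h1 h2 => ?_, ?_, ?_⟩
      · have := hv' ⟨i, by omega⟩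
        simp only [T0] at this
        rwa [if_neg (by omega)] at this
      · simpa [T0] using hv' ⟨0, by omega⟩
      · simpa [T0] using hv' ⟨n, by omega⟩
    have s2 : LinScheme bc (fun _ => 0) ε x n (fun _ => 0) := by
      refine ⟨fun i _ _ => ?_, rfl, rfl⟩
      simp [ddiff]
    have := disc_unique hx hc s1 s2
    funext i
    have h : extZ n v i = 0 := this i (by omega)
    unfold extZ at h
    rw [dif_pos i.2] at h
    exact h
  have surj : Function.Surjective T := LinearMap.injective_iff_surjective.1 inj
  obtain ⟨v, hv⟩ := surj (fun i => if (i:ℕ) = 0 ∨ (i:ℕ) = n then 0 else gc (x i))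
  have hv' : ∀ i : Fin (n+1), T0 v i = if (i:ℕ) = 0 ∨ (i:ℕ) = n then 0 else gc (x i) :=
    fun i => congrFun hv i
  refine ⟨extZ n v, fun i h1 h2 => ?_, ?_, ?_⟩
  · have := hv' ⟨i, by omega⟩
    simp only [T0] at this
    rwa [if_neg (by omega), if_neg (by omega)] at this
  · simpa [T0] using hv' ⟨0, by omega⟩
  · simpa [T0] using hv' ⟨n, by omega⟩

/-- piecewise formulas for the Shishkin mesh with `4m` cells -/
structure IsMesh (α δ H : ℝ) (m : ℕ) (x : ℕ → ℝ) : Prop where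
  lo : ∀ i ≤ m, x i = δ * i
  mid : ∀ i, m ≤ i → i ≤ 3*m → x i = α + H * (i - m)
  hi : ∀ i, 3*m ≤ i → i ≤ 4*m → x i = 1 - δ * (4*m - i)

lemma shishkin_isMesh {γ ε : ℝ} {m : ℕ} (hm : 1 ≤ m) :
    IsMesh (min (1/4) (2 * γ⁻¹ * ε * Real.log ((4*m : ℕ) : ℝ)))
      (min (1/4) (2 * γ⁻¹ * ε * Real.log ((4*m : ℕ) : ℝ)) / m)
      ((1 - 2 * min (1/4) (2 * γ⁻¹ * ε * Real.log ((4*m : ℕ) : ℝ))) / (2*m)) m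
      (shishkinMesh γ ε (4*m)) := by
  have hm0 : (0:ℝ) < m := by exact_mod_cast hm
  have hm4 : ((4*m : ℕ) : ℝ) = 4 * m := by push_cast; ring
  constructor
  · intro i hi
    have hi' : (i:ℝ) ≤ m := by exact_mod_cast hi
    unfold shishkinMesh shishkinLam
    rw [hm4]
    generalize min (1/4) (2 * γ⁻¹ * ε * Real.log (4*(m:ℝ))) = α
    rw [if_pos (by rw [div_le_iff₀ (by positivity)]; linarith)]
    field_simp
  · intro i h1 h2
    have h1' : (m:ℝ) ≤ i := by exact_mod_cast h1
    have h2' : (i:ℝ) ≤ 3*m := by exact_mod_cast h2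
    unfold shishkinMesh shishkinLam
    rw [hm4]
    generalize min (1/4) (2 * γ⁻¹ * ε * Real.log (4*(m:ℝ))) = α
    simp only
    split_ifs with c1 c2 c3
    · rw [div_le_iff₀ (by positivity)] at c1
      have : (i:ℝ) = m := by linarith
      rw [this]; field_simp; ring
    · field_simp; ring
    · have : (i:ℝ) = 3*m := by
        have : (1 - (i:ℝ)/(4*m)) * (4*m) ≤ 1/4 * (4*m) := by gcongr
        rw [sub_mul, div_mul_cancel₀ _ (by positivity)] at this
        linarith
      rw [this]; field_simp; ring
    · field_simp; ring
  · intro i h1 h2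
    have h1' : 3*(m:ℝ) ≤ i := by exact_mod_cast h1
    have h2' : (i:ℝ) ≤ 4*m := by exact_mod_cast h2
    unfold shishkinMesh shishkinLam
    rw [hm4]
    generalize min (1/4) (2 * γ⁻¹ * ε * Real.log (4*(m:ℝ))) = α
    simp only
    rw [if_neg (by rw [div_le_iff₀ (by positivity)]; push Not; linarith),
      if_neg (by rw [div_le_iff₀ (by positivity)]; push Not; linarith),
      if_pos (by rw [sub_le_iff_le_add, ← sub_le_iff_le_add', le_div_iff₀ (by positivity)]; linarith)]
    field_simp

/-- barrier for transition points -/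
def thb (α δ : ℝ) (m i : ℕ) : ℝ :=
  if i ≤ m then δ * i else if i ≤ 3*m then α else δ * (4*m - i)

lemma thb_mesh {α δ : ℝ} {m : ℕ} (hδ : m * δ = α) : 
    (∀ i ≤ m, thb α δ m i = δ * i) ∧ (∀ i, m ≤ i → i ≤ 3*m → thb α δ m i = α) ∧
    (∀ i, 3*m ≤ i → i ≤ 4*m → thb α δ m i = δ * (4*m - i)) := by
  unfold thb
  refine ⟨fun i hi => if_pos hi, fun i h1 h2 => ?_, fun i h1 h2 => ?_⟩
  · split_ifs with c
    · have : i = m := le_antisymm c h1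
      subst this; linarith
    · rfl
  · split_ifs with c1 c2
    · have : m = 0 := by omega
      subst this
      have : i = 0 := by omega
      subst this; simp
    · have : i = 3*m := le_antisymm c2 h1
      subst this; push_cast; linarith
    · rfl

lemma thb_bd {α δ : ℝ} {m : ℕ} (hδ : m * δ = α) (hδ0 : 0 < δ) :
    ∀ i ≤ 4*m, 0 ≤ thb α δ m i ∧ thb α δ m i ≤ α := by
  intro i hi
  have hi' : (i:ℝ) ≤ 4*m := by exact_mod_cast hi
  unfold thb
  split_ifs with c1 c2
  · have : (i:ℝ) ≤ m := by exact_mod_cast c1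
    constructor
    · positivity
    · nlinarith
  · have : (0:ℝ) ≤ m := by positivity
    constructor <;> nlinarith
  · have : 3*(m:ℝ) ≤ i := by exact_mod_cast (by omega : 3*m ≤ i)
    constructor <;> nlinarith

lemma mesh_cases {α δ H : ℝ} {m : ℕ} {x : ℕ → ℝ} (hM : IsMesh α δ H m x) (hm : 1 ≤ m)
    (hδ : m * δ = α) (hH : 2 * m * H = 1 - 2 * α) (hδ0 : 0 < δ) (hH0 : 0 < H)
    (i : ℕ) (h1 : 1 ≤ i) (h2 : i < 4*m) :
    ∃ h k, 0 < h ∧ 0 < k ∧ x (i-1) = x i - h ∧ x (i+1) = x i + k ∧ 0 ≤ x i - h ∧ x i + k ≤ 1 ∧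
      ((h = δ ∧ k = δ ∧ dd h k (thb α δ m (i-1)) (thb α δ m i) (thb α δ m (i+1)) = 0) ∨
       (h = H ∧ k = H ∧ α ≤ x i - h ∧ x i + k ≤ 1 - α ∧ 
        dd h k (thb α δ m (i-1)) (thb α δ m i) (thb α δ m (i+1)) = 0) ∨
       (((h = δ ∧ k = H) ∨ (h = H ∧ k = δ)) ∧ α - δ ≤ x i - h ∧ x i + k ≤ 1 - (α - δ) ∧ 
        dd h k (thb α δ m (i-1)) (thb α δ m i) (thb α δ m (i+1)) = -2 / (δ + H))) := by
  obtain ⟨T1, T2, T3⟩ := thb_mesh hδ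
  obtain ⟨j, rfl⟩ : ∃ j, i = j + 1 := ⟨i - 1, by omega⟩
  rw [Nat.add_sub_cancel]
  have hm0 : (1:ℝ) ≤ m := by exact_mod_cast hm
  have hj0 : (0:ℝ) ≤ j := by positivity
  have hα : 0 < α := by rw [← hδ]; positivity
  have hα1 : α < 1/2 := by nlinarith
  have hlt : j + 1 < m ∨ j + 1 = m ∨ (m < j+1 ∧ j+1 < 3*m) ∨ j+1 = 3*m ∨ (3*m < j+1) := by omega
  have r2 : ∀ y z : ℝ, z = 0 → 2 / y * z = 0 := by intro y z h; rw [h, mul_zero]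
  rcases hlt with c | c | ⟨c, c'⟩ | c | c
  · have c' : (j:ℝ) + 1 + 1 ≤ m := by exact_mod_cast c
    rw [T1 j (by omega), T1 (j+1) (by omega), T1 (j+1+1) (by omega),
      hM.lo j (by omega), hM.lo (j+1) (by omega), hM.lo (j+1+1) (by omega)]
    push_cast
    refine ⟨δ, δ, hδ0, hδ0, by ring, by ring, by nlinarith, by nlinarith, Or.inl ⟨rfl, rfl, ?_⟩⟩
    unfold dd
    apply r2
    field_simp; ring
  · have c' : (j:ℝ) + 1 = m := by exact_mod_cast c
    rw [T1 j (by omega), T1 (j+1) (by omega), T2 (j+1+1) (by omega) (by omega),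
      hM.lo j (by omega), hM.lo (j+1) (by omega), hM.mid (j+1+1) (by omega) (by omega)]
    push_cast
    refine ⟨δ, H, hδ0, hH0, by ring, ?_, ?_, ?_, Or.inr (Or.inr ⟨Or.inl ⟨rfl, rfl⟩, ?_, ?_, ?_⟩)⟩
    · rw [c']; linarith
    · nlinarith
    · rw [c']; nlinarith
    · rw [c']; linarith
    · rw [c']; nlinarith
    · have e : δ * ((j:ℝ)+1) = α := by rw [c']; linarith
      rw [e]
      have e2 : δ * (j:ℝ) = α - δ := by linarith
      rw [e2]; unfold dd
      field_simp; ring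
  · have k1 : (m:ℝ) ≤ j := by exact_mod_cast (by omega : m ≤ j)
    have k2 : (j:ℝ) + 1 + 1 ≤ 3*m := by exact_mod_cast (by omega : j + 1 + 1 ≤ 3*m)
    rw [T2 j (by omega) (by omega), T2 (j+1) (by omega) (by omega), T2 (j+1+1) (by omega) (by omega),
      hM.mid j (by omega) (by omega), hM.mid (j+1) (by omega) (by omega),
      hM.mid (j+1+1) (by omega) (by omega)]
    push_cast
    refine ⟨H, H, hH0, hH0, by ring, by ring, ?_, ?_, Or.inr (Or.inl ⟨rfl, rfl, ?_, ?_, ?_⟩)⟩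
    · nlinarith
    · nlinarith
    · nlinarith
    · nlinarith
    · simp [dd]
  · have c' : (j:ℝ) + 1 = 3*m := by exact_mod_cast c
    rw [T2 j (by omega) (by omega), T3 (j+1) (by omega) (by omega), T3 (j+1+1) (by omega) (by omega),
      hM.mid j (by omega) (by omega), hM.hi (j+1) (by omega) (by omega),
      hM.hi (j+1+1) (by omega) (by omega)]
    push_cast
    have e0 : (j:ℝ) = 3*m - 1 := by linarith
    refine ⟨H, δ, hH0, hδ0, ?_, by ring, ?_, ?_, Or.inr (Or.inr ⟨Or.inr ⟨rfl, rfl⟩, ?_, ?_, ?_⟩)⟩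
    · rw [e0]; linarith
    · rw [e0]; nlinarith
    · rw [e0]; nlinarith
    · rw [e0]; nlinarith
    · rw [e0]; linarith
    · have e : δ * (4 * (m:ℝ) - ((j:ℝ)+1)) = α := by rw [e0]; linarith
      have e' : δ * (4 * (m:ℝ) - ((j:ℝ)+1+1)) = α - δ := by rw [e0]; linarith
      rw [e, e']
      unfold dd
      field_simp; ring
  · have k1 : 3*(m:ℝ) ≤ j := by exact_mod_cast (by omega : 3*m ≤ j)
    have k2 : (j:ℝ) + 1 + 1 ≤ 4*m := by exact_mod_cast (by omega : j + 1 + 1 ≤ 4*m)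
    rw [T3 j (by omega) (by omega), T3 (j+1) (by omega) (by omega), T3 (j+1+1) (by omega) (by omega),
      hM.hi j (by omega) (by omega), hM.hi (j+1) (by omega) (by omega),
      hM.hi (j+1+1) (by omega) (by omega)]
    push_cast
    refine ⟨δ, δ, hδ0, hδ0, by ring, by ring, by nlinarith, by nlinarith, Or.inl ⟨rfl, rfl, ?_⟩⟩
    unfold dd
    apply r2
    field_simp; ring

lemma mesh_bd {α δ H : ℝ} {m : ℕ} {x : ℕ → ℝ} (hM : IsMesh α δ H m x) (hm : 1 ≤ m)
    (hδ : m * δ = α) (hH : 2 * m * H = 1 - 2 * α) (hδ0 : 0 < δ) (hH0 : 0 < H) :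
    x 0 = 0 ∧ x (4*m) = 1 ∧ (∀ i < 4*m, x i < x (i+1)) ∧ ∀ i ≤ 4*m, x i ∈ Icc (0:ℝ) 1 := by
  have a0 : x 0 = 0 := by rw [hM.lo 0 (by omega)]; simp
  have a1 : x (4*m) = 1 := by rw [hM.hi _ (by omega) (by omega)]; push_cast; ring
  refine ⟨a0, a1, ?_, ?_⟩
  · intro i hi
    rcases Nat.eq_zero_or_pos i with rfl | hp
    · obtain ⟨h, k, hh, hk, e1, e2, -⟩ := mesh_cases hM hm hδ hH hδ0 hH0 1 (by omega) (by omega)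
      simp only [Nat.sub_self] at e1
      rw [e1]; simp; linarith
    · obtain ⟨h, k, hh, hk, e1, e2, -⟩ := mesh_cases hM hm hδ hH hδ0 hH0 i (by omega) (by omega)
      linarith
  · intro i hi
    rcases Nat.eq_zero_or_pos i with rfl | hp
    · simp [a0]
    · rcases hi.eq_or_lt with rfl | hlt
      · simp [a1]
      · obtain ⟨h, k, hh, hk, e1, e2, e3, e4, -⟩ := mesh_cases hM hm hδ hH hδ0 hH0 i (by omega) (by omega)
        exact ⟨by linarith, by linarith⟩

/-- Local truncation estimates. -/
lemma trunc_all {γ ε C x h k S : ℝ} {u0 u1 u2 u3 u4 : ℝ → ℝ} (hε : 0 < ε)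
    (d0 : DvOn 0 1 u0 u1) (d1 : DvOn 0 1 u1 u2) (d2 : DvOn 0 1 u2 u3) (d3 : DvOn 0 1 u3 u4)
    (hC : 0 ≤ C)
    (hB : ∀ t ∈ Icc (0:ℝ) 1, ε^2 * |u2 t| ≤ C * (ε^2 + lay γ ε t) ∧
      ε^3 * |u3 t| ≤ C * (ε^2 + lay γ ε t) ∧ ε^4 * |u4 t| ≤ C * (ε^2 + lay γ ε t))
    (hh : 0 < h) (hk : 0 < k) (hx0 : 0 ≤ x - h) (hx1 : x + k ≤ 1)
    (hS : ∀ t ∈ Icc (x-h) (x+k), ε^2 + lay γ ε t ≤ S) :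
    ε^2 * |dd h k (u0 (x-h)) (u0 x) (u0 (x+k)) - u2 x| ≤ 3 * (C * S) ∧
    ε^2 * |dd h k (u0 (x-h)) (u0 x) (u0 (x+k)) - u2 x| ≤ 2 * ((h + k)/ε) * (C * S) ∧
    (h = k → ε^2 * |dd h k (u0 (x-h)) (u0 x) (u0 (x+k)) - u2 x| ≤ 2 * (h/ε)^2 * (C * S)) := by
  have sub : ∀ t ∈ Icc (x-h) (x+k), t ∈ Icc (0:ℝ) 1 := fun t ht =>
    ⟨hx0.trans ht.1, ht.2.trans hx1⟩
  have hCS : ∀ t ∈ Icc (x-h) (x+k), C * (ε^2 + lay γ ε t) ≤ C * S := fun t ht => by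
    gcongr; exact hS t ht
  refine ⟨?_, ?_, ?_⟩
  · have := trunc2 (K := C * S / ε^2) hh hk (d0.mono hx0 hx1) (d1.mono hx0 hx1) (fun t ht => by
      rw [le_div_iff₀ (by positivity), mul_comm]
      exact (hB t (sub t ht)).1.trans (hCS t ht))
    calc _ ≤ ε^2 * (3 * (C * S / ε^2)) := by gcongr
      _ = _ := by field_simp
  · have := trunc3 (K := C * S / ε^3) hh hk (d0.mono hx0 hx1) (d1.mono hx0 hx1) (d2.mono hx0 hx1)
      (fun t ht => by
      rw [le_div_iff₀ (by positivity), mul_comm]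
      exact (hB t (sub t ht)).2.1.trans (hCS t ht))
    calc _ ≤ ε^2 * (2 * (h + k) * (C * S / ε^3)) := by gcongr
      _ = _ := by field_simp
  · rintro rfl
    have := trunc4 (K := C * S / ε^4) hh (d0.mono hx0 hx1) (d1.mono hx0 hx1) (d2.mono hx0 hx1)
      (d3.mono hx0 hx1) (fun t ht => by
      rw [le_div_iff₀ (by positivity), mul_comm]
      exact (hB t (sub t ht)).2.2.trans (hCS t ht))
    calc _ ≤ ε^2 * (2 * h^2 * (C * S / ε^4)) := by gcongr
      _ = _ := by field_simp

/-- the constant in the truncation estimate -/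
def Kc (γ : ℝ) : ℝ := 400 * (γ⁻¹)^2 + 4 * (1 + 2 * Real.exp 8) + 24

set_option maxHeartbeats 1000000 in
lemma mesh_trunc {γ ε C α δ H : ℝ} {m : ℕ} {x : ℕ → ℝ} {u0 u1 u2 u3 u4 : ℝ → ℝ}
    (hγ : 0 < γ) (hε : 0 < ε) (hε1 : ε ≤ 1)
    (d0 : DvOn 0 1 u0 u1) (d1 : DvOn 0 1 u1 u2) (d2 : DvOn 0 1 u2 u3) (d3 : DvOn 0 1 u3 u4)
    (hC : 0 ≤ C)
    (hB : ∀ t ∈ Icc (0:ℝ) 1, ε^2 * |u2 t| ≤ C * (ε^2 + lay γ ε t) ∧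
      ε^3 * |u3 t| ≤ C * (ε^2 + lay γ ε t) ∧ ε^4 * |u4 t| ≤ C * (ε^2 + lay γ ε t))
    (hM : IsMesh α δ H m x) (hm : 1 ≤ m)
    (hδ : m * δ = α) (hH : 2 * m * H = 1 - 2 * α) (hδ0 : 0 < δ) (hH0 : 0 < H)
    (n l : ℝ) (hn : n = 4 * m) (hl : l = Real.log n) (hl1 : 1 ≤ l)
    (hα1 : α ≤ 2 * γ⁻¹ * ε * l) (hα : α = 1/4 ∨ α = 2 * γ⁻¹ * ε * l)
    (i : ℕ) (h1 : 1 ≤ i) (h2 : i < 4*m) :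
    ε^2 * |ddiff x (fun j => u0 (x j)) i - u2 (x i)| ≤
      Kc γ * C * (l^2 / n^2) + Kc γ * C * (ε / n^2) * (-ddiff x (thb α δ m) i) := by
  have hm0 : (1:ℝ) ≤ m := by exact_mod_cast hm
  have hn0 : 0 < n := by rw [hn]; positivity
  have hl0 : 0 < l := by linarith
  have hαp : 0 < α := by rw [← hδ]; positivity
  have hsum : δ + H = 2 / n := by
    rw [hn]; field_simp; nlinarith
  have hδn : δ = 4 * α / n := by rw [hn, ← hδ]; field_simp
  have hγi : 0 < γ⁻¹ := by positivity
  obtain ⟨h, k, hh, hk, e1, e2, e3, e4, hc⟩ := mesh_cases hM hm hδ hH hδ0 hH0 i h1 h2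
  rw [ddiff_eq_dd e1 e2, ddiff_eq_dd e1 e2]
  rw [e1, e2]
  have trivS : ∀ t ∈ Icc (x i - h) (x i + k), ε^2 + lay γ ε t ≤ 3 := by
    intro t ht
    have := lay_le_two (γ := γ) (ε := ε) hγ hε (⟨e3.trans ht.1, ht.2.trans e4⟩ : t ∈ Icc (0:ℝ) 1)
    nlinarith
  have l2n : 1 / n^2 ≤ l^2 / n^2 := by
    gcongr
    nlinarith
  have hKp : 0 < Kc γ := by unfold Kc; positivity
  have he8 := Real.exp_pos 8
  -- uniform fine estimate
  have fine : h = δ → k = δ → ε^2 * |dd h k (u0 (x i - h)) (u0 (x i)) (u0 (x i + k)) - u2 (x i)| 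
      ≤ Kc γ * C * (l^2 / n^2) := by
    intro a1 a2
    have T := (trunc_all hε d0 d1 d2 d3 hC hB hh hk e3 e4 trivS).2.2 (by rw [a1, a2])
    refine T.trans ?_
    have : h / ε ≤ 8 * γ⁻¹ * l / n := by
      rw [a1, hδn, div_le_iff₀ hε, div_mul_eq_mul_div]
      refine div_le_div_of_nonneg_right ?_ hn0.le
      linarith
    calc 2 * (h/ε)^2 * (C * 3) ≤ 2 * (8 * γ⁻¹ * l / n)^2 * (C * 3) := by gcongr
      _ = (384 * γ⁻¹^2) * C * (l^2/n^2) := by ring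
      _ ≤ _ := by
        gcongr
        unfold Kc
        linarith [sq_nonneg γ⁻¹]
  have expα : α = 2 * γ⁻¹ * ε * l → Real.exp (-γ * α / ε) = 1 / n^2 := by
    intro h
    have : -γ * α / ε = -(l + l) := by rw [h]; field_simp; ring
    rw [this, Real.exp_neg, Real.exp_add, hl, Real.exp_log hn0]
    field_simp
  rcases hc with ⟨a1, a2, a3⟩ | ⟨a1, a2, a3, a4, a5⟩ | ⟨a1, a3, a4, a5⟩
  · rw [a3]
    simpa using fine a1 a2
  · rw [a5]
    simp only [neg_zero, mul_zero, add_zero]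
    rcases hα with hα | hα
    · have : δ = H := by
        rw [hα] at hδn
        have : δ = 1/n := by rw [hδn]; ring
        have h3 : (2:ℝ) / n = 1/n + 1/n := by ring
        linarith
      rw [← this] at a1 a2
      exact fine a1 a2
    · have SS : ∀ t ∈ Icc (x i - h) (x i + k), ε^2 + lay γ ε t ≤ ε^2 + 2 * (1/n^2) := by
        intro t ht
        have := lay_le (a := α) (b := α) hγ hε (a3.trans ht.1) (ht.2.trans a4)
        rw [expα hα] at this
        linarith
      have T := trunc_all hε d0 d1 d2 d3 hC hB hh hk e3 e4 SS
      have Hn : h ≤ 2 / n := by rw [a1]; linarith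
      have K24 : 24 ≤ Kc γ := by unfold Kc; linarith [sq_nonneg γ⁻¹]
      refine le_trans ?_ (by gcongr : 24 * C * (1/n^2) ≤ Kc γ * C * (l^2/n^2))
      rcases le_total ε (1/n) with hc | hc
      · refine T.1.trans ?_
        have : ε^2 ≤ 1/n^2 := by
          calc ε^2 ≤ (1/n)^2 := by gcongr
            _ = _ := by ring
        calc 3 * (C * (ε^2 + 2 * (1/n^2))) ≤ 3 * (C * (1/n^2 + 2 * (1/n^2))) := by gcongr
          _ = 9 * C * (1/n^2) := by ring
          _ ≤ _ := by gcongr; norm_num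
      · refine (T.2.2 (by rw [a1, a2])).trans ?_
        have : 1/n^2 ≤ ε^2 := by
          calc 1/n^2 = (1/n)^2 := by ring
            _ ≤ _ := by gcongr
        calc 2 * (h/ε)^2 * (C * (ε^2 + 2 * (1/n^2))) ≤ 2 * ((2/n)/ε)^2 * (C * (ε^2 + 2 * ε^2)) := by
              gcongr
          _ = 24 * C * (1/n^2) := by field_simp; ring
  · have tn : -(-2 / (δ + H)) = n := by rw [hsum]; field_simp
    rw [a5, tn]
    have second : 0 ≤ Kc γ * C * (ε/n^2) * n := by positivity
    have first : 0 ≤ Kc γ * C * (l^2/n^2) := by positivity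
    rcases hα with hα | hα
    · have : δ = H := by
        rw [hα] at hδn
        have : δ = 1/n := by rw [hδn]; ring
        have h3 : (2:ℝ) / n = 1/n + 1/n := by ring
        linarith
      rw [← this] at a1
      have := fine (by rcases a1 with h | h <;> exact h.1) (by rcases a1 with h | h <;> exact h.2)
      linarith
    · have eb : Real.exp (-γ * (α - δ) / ε) ≤ Real.exp 8 * (1/n^2) := by
        rw [← expα hα, ← Real.exp_add]
        apply Real.exp_le_exp.2
        have : -γ * (α - δ) / ε = γ * δ / ε + -γ * α / ε := by ring
        rw [this]
        gcongr
        rw [hδn, hα]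
        have : γ * (4 * (2 * γ⁻¹ * ε * l) / n) / ε = 8 * (l / n) := by field_simp; ring
        rw [this]
        have : l / n ≤ 1 := by
          rw [div_le_one hn0, hl]
          linarith [Real.log_le_sub_one_of_pos hn0]
        linarith
      have SS : ∀ t ∈ Icc (x i - h) (x i + k), ε^2 + lay γ ε t ≤ ε^2 + 2 * Real.exp 8 * (1/n^2) := by
        intro t ht
        have := lay_le (a := α - δ) (b := α - δ) hγ hε (a3.trans ht.1) (ht.2.trans a4)
        linarith
      have T := trunc_all hε d0 d1 d2 d3 hC hB hh hk e3 e4 SS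
      have K4 : 4 * (1 + 2 * Real.exp 8) ≤ Kc γ := by unfold Kc; linarith [sq_nonneg γ⁻¹]
      rcases le_total ε (1/n) with hc | hc
      · refine T.1.trans ?_
        have : ε^2 ≤ 1/n^2 := by
          calc ε^2 ≤ (1/n)^2 := by gcongr
            _ = _ := by ring
        have : 3 * (C * (ε^2 + 2 * Real.exp 8 * (1/n^2))) ≤ Kc γ * C * (l^2/n^2) := by
          calc 3 * (C * (ε^2 + 2 * Real.exp 8 * (1/n^2)))
              ≤ 3 * (C * (1/n^2 + 2 * Real.exp 8 * (1/n^2))) := by gcongr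
            _ = 3 * (1 + 2 * Real.exp 8) * C * (1/n^2) := by ring
            _ ≤ _ := by gcongr; linarith
        linarith
      · refine T.2.1.trans ?_
        have : 1/n^2 ≤ ε^2 := by
          calc 1/n^2 = (1/n)^2 := by ring
            _ ≤ _ := by gcongr
        have hk2 : h + k = 2/n := by rcases a1 with h | h <;> rw [h.1, h.2] <;> linarith
        have : 2 * ((h+k)/ε) * (C * (ε^2 + 2 * Real.exp 8 * (1/n^2))) ≤ Kc γ * C * (ε/n^2) * n := by
          rw [hk2]
          calc 2 * ((2/n)/ε) * (C * (ε^2 + 2 * Real.exp 8 * (1/n^2)))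
              ≤ 2 * ((2/n)/ε) * (C * (ε^2 + 2 * Real.exp 8 * ε^2)) := by gcongr
            _ = 4 * (1 + 2 * Real.exp 8) * (C * (ε/n^2) * n) := by field_simp; ring
            _ ≤ Kc γ * (C * (ε/n^2) * n) := by gcongr
            _ = _ := by ring
        linarith

lemma error_bound {γ ε β C α δ H : ℝ} {m : ℕ} {x y : ℕ → ℝ} {bc gc u0 u1 u2 u3 u4 : ℝ → ℝ}
    (hγ : 0 < γ) (hβ : 0 < β) (hε : 0 < ε) (hε1 : ε ≤ 1)
    (d0 : DvOn 0 1 u0 u1) (d1 : DvOn 0 1 u1 u2) (d2 : DvOn 0 1 u2 u3) (d3 : DvOn 0 1 u3 u4)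
    (hC : 0 ≤ C)
    (hB : ∀ t ∈ Icc (0:ℝ) 1, ε^2 * |u2 t| ≤ C * (ε^2 + lay γ ε t) ∧
      ε^3 * |u3 t| ≤ C * (ε^2 + lay γ ε t) ∧ ε^4 * |u4 t| ≤ C * (ε^2 + lay γ ε t))
    (hM : IsMesh α δ H m x) (hm : 1 ≤ m)
    (hδ : m * δ = α) (hH : 2 * m * H = 1 - 2 * α) (hδ0 : 0 < δ) (hH0 : 0 < H)
    (n l : ℝ) (hn : n = 4 * m) (hl : l = Real.log n) (hl1 : 1 ≤ l)
    (hα1 : α ≤ 2 * γ⁻¹ * ε * l) (hα : α = 1/4 ∨ α = 2 * γ⁻¹ * ε * l)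
    (hbβ : ∀ t ∈ Icc (0:ℝ) 1, β ≤ bc t)
    (hu : ∀ t ∈ Icc (0:ℝ) 1, -ε^2 * u2 t + bc t * u0 t = gc t) (hu0 : u0 0 = 0) (hu1 : u0 1 = 0)
    (hy : LinScheme bc gc ε x (4*m) y) :
    ∀ i ≤ 4*m, |u0 (x i) - y i| ≤ Kc γ * C * (β⁻¹ + 2 * γ⁻¹) * (l^2 / n^2) := by
  obtain ⟨x0, x1, xm, xI⟩ := mesh_bd hM hm hδ hH hδ0 hH0
  have hm0 : (1:ℝ) ≤ m := by exact_mod_cast hm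
  have hn0 : 0 < n := by rw [hn]; positivity
  have hKp : 0 < Kc γ := by unfold Kc; positivity
  have hγi : 0 < γ⁻¹ := by positivity
  have hαp : 0 < α := by rw [← hδ]; positivity
  set T := Kc γ * C with hT
  have hT0 : 0 ≤ T := by positivity
  have key : ∀ s : ℝ, (s = 1 ∨ s = -1) → ∀ i ≤ 4*m,
      0 ≤ 1 * (1 * (T * β⁻¹ * (l^2/n^2)) + T / (ε * n^2) * thb α δ m i) + s * (1 * u0 (x i) + (-1) * y i) := by
    intro s hs
    refine disc_max (φ := fun i => 1 * (1 * (T * β⁻¹ * (l^2/n^2)) + T / (ε * n^2) * thb α δ m i) 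
      + s * (1 * u0 (x i) + (-1) * y i)) (c := fun i => bc (x i)) (ε := ε) xm ?_ ?_ ?_ ?_
    · intro i h1 h2
      exact lt_of_lt_of_le hβ (hbβ _ (xI i h2.le))
    · intro i h1 h2
      rw [ddiff_lin x (fun i => 1 * (T * β⁻¹ * (l^2/n^2)) + T / (ε * n^2) * thb α δ m i)
        (fun i => 1 * u0 (x i) + (-1) * y i), 
        ddiff_lin x (fun i => (T * β⁻¹ * (l^2/n^2))) (thb α δ m), 
        ddiff_lin x (fun i => u0 (x i)) y]
      have c0 : ddiff x (fun _ => (T * β⁻¹ * (l^2/n^2))) i = 0 := by simp [ddiff]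
      rw [c0]
      have tr := mesh_trunc hγ hε hε1 d0 d1 d2 d3 hC hB hM hm hδ hH hδ0 hH0 n l hn hl hl1 hα1 hα i h1 h2
      rw [← hT] at tr
      have a1 := hy.1 i h1 h2
      have a2 := hu (x i) (xI i h2.le)
      have a3 := hbβ _ (xI i h2.le)
      obtain ⟨a4, -⟩ := thb_bd hδ hδ0 i h2.le
      set D := ddiff x (fun j => u0 (x j)) i
      set Dy := ddiff x y i
      set Dθ := ddiff x (thb α δ m) i
      have b1 : T * (l^2/n^2) ≤ bc (x i) * (T * β⁻¹ * (l^2/n^2)) := by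
        calc T * (l^2/n^2) = β * (T * β⁻¹ * (l^2/n^2)) := by field_simp
          _ ≤ _ := by gcongr
      have b2 : 0 ≤ bc (x i) * (T / (ε * n^2) * thb α δ m i) := by
        have : 0 ≤ bc (x i) := by linarith
        positivity
      have b3 : -ε^2 * (T / (ε * n^2) * Dθ) = T * (ε/n^2) * (-Dθ) := by
        field_simp
      have b4 : |ε^2 * (D - u2 (x i))| ≤ T * (l^2/n^2) + T * (ε/n^2) * (-Dθ) := by
        rw [abs_mul, abs_of_pos (by positivity : 0 < ε^2)]; exact tr
      rw [abs_le] at b4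
      have b5 : -ε^2 * (D - Dy) + bc (x i) * (u0 (x i) - y i) = -(ε^2 * (D - u2 (x i))) := by
        linear_combination a2 - a1
      have b6 : 0 ≤ T * (l^2/n^2) + T * (ε/n^2) * (-Dθ)
          + s * (-ε^2 * (D - Dy) + bc (x i) * (u0 (x i) - y i)) := by
        rw [b5]
        rcases hs with rfl | rfl <;> linarith [b4.1, b4.2]
      linarith
    · simp only [x0, hu0, hy.2.1]
      obtain ⟨a4, -⟩ := thb_bd hδ hδ0 0 (by omega : 0 ≤ 4*m)
      have : 0 ≤ T * β⁻¹ * (l^2/n^2) := by positivity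
      have : 0 ≤ T / (ε * n^2) * thb α δ m 0 := by positivity
      linarith
    · simp only [x1, hu1, hy.2.2]
      obtain ⟨a4, -⟩ := thb_bd hδ hδ0 (4*m) le_rfl
      have : 0 ≤ T * β⁻¹ * (l^2/n^2) := by positivity
      have : 0 ≤ T / (ε * n^2) * thb α δ m (4*m) := by positivity
      linarith
  intro i hi
  have k1 := key 1 (Or.inl rfl) i hi
  have k2 := key (-1) (Or.inr rfl) i hi
  obtain ⟨-, a4⟩ := thb_bd hδ hδ0 i hi
  have : T / (ε * n^2) * thb α δ m i ≤ T * (2 * γ⁻¹) * (l^2/n^2) := by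
    calc T / (ε * n^2) * thb α δ m i ≤ T / (ε * n^2) * (2 * γ⁻¹ * ε * l) := by
          gcongr; exact a4.trans hα1
      _ = T * (2 * γ⁻¹) * (l/n^2) := by field_simp
      _ ≤ _ := by gcongr; nlinarith
  rw [abs_le]
  constructor <;> linarith

lemma dv_iter {f : ℝ → ℝ} {N : ℕ} (hf : ContDiffOn ℝ N f (Icc (0:ℝ) 1)) (j : ℕ) (hj : j < N) :
    DvOn 0 1 (iteratedDerivWithin j f (Icc (0:ℝ) 1))
      (iteratedDerivWithin (j+1) f (Icc (0:ℝ) 1)) := by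
  intro t ht
  have := hf.differentiableOn_iteratedDerivWithin (m := j) (by exact_mod_cast hj)
    (uniqueDiffOn_Icc zero_lt_one) t ht
  rw [iteratedDerivWithin_succ]
  exact this.hasDerivWithinAt

lemma dv_zero {f : ℝ → ℝ} {N : ℕ} (hf : ContDiffOn ℝ N f (Icc (0:ℝ) 1)) (hj : 0 < N) :
    DvOn 0 1 f (iteratedDerivWithin 1 f (Icc (0:ℝ) 1)) := by
  have := dv_iter hf 0 hj
  rwa [iteratedDerivWithin_zero] at this

/-- bounds for the reduced solution `g/b` -/
lemma quot_bounds {β M : ℝ} (hβ : 0 < β) (hM : 0 ≤ M) : ∃ K : ℝ, 0 ≤ K ∧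
    ∀ b0 b1 b2 g0 g1 g2 : ℝ → ℝ, DvOn 0 1 b0 b1 → DvOn 0 1 b1 b2 → DvOn 0 1 g0 g1 →
      DvOn 0 1 g1 g2 → (∀ t ∈ Icc (0:ℝ) 1, β ≤ b0 t) →
      (∀ t ∈ Icc (0:ℝ) 1, |b1 t| ≤ M) → (∀ t ∈ Icc (0:ℝ) 1, |b2 t| ≤ M) →
      (∀ t ∈ Icc (0:ℝ) 1, |g0 t| ≤ M) → (∀ t ∈ Icc (0:ℝ) 1, |g1 t| ≤ M) →
      (∀ t ∈ Icc (0:ℝ) 1, |g2 t| ≤ M) →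
      ∃ r0 r1 r2 : ℝ → ℝ, DvOn 0 1 r0 r1 ∧ DvOn 0 1 r1 r2 ∧
        (∀ t ∈ Icc (0:ℝ) 1, b0 t * r0 t = g0 t) ∧
        (∀ t ∈ Icc (0:ℝ) 1, |r0 t| ≤ K) ∧ (∀ t ∈ Icc (0:ℝ) 1, |r2 t| ≤ β * K) := by
  set R0 := M / β with hR0
  set R1 := (M + R0 * M) / β with hR1
  set R2 := (M + R1 * M + (R1 * M + R0 * M)) / β with hR2
  have p0 : 0 ≤ R0 := by positivity
  have p1 : 0 ≤ R1 := by positivity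
  have p2 : 0 ≤ R2 := by positivity
  refine ⟨R0 + R2 / β, by positivity, ?_⟩
  intro b0 b1 b2 g0 g1 g2 db0 db1 dg0 dg1 hb mb1 mb2 mg0 mg1 mg2
  have hbp : ∀ t ∈ Icc (0:ℝ) 1, 0 < b0 t := fun t ht => hβ.trans_le (hb t ht)
  have q : ∀ t ∈ Icc (0:ℝ) 1, ∀ X Y : ℝ, |X| ≤ Y → |X / b0 t| ≤ Y / β := by
    intro t ht X Y h
    rw [abs_div, abs_of_pos (hbp t ht)]
    have : 0 ≤ Y := (abs_nonneg _).trans h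
    have := hb t ht
    gcongr
  have bd0 : ∀ t ∈ Icc (0:ℝ) 1, |g0 t / b0 t| ≤ R0 := fun t ht => q t ht _ _ (mg0 t ht)
  have bd1 : ∀ t ∈ Icc (0:ℝ) 1, |(g1 t - g0 t / b0 t * b1 t) / b0 t| ≤ R1 := fun t ht => by
    apply q t ht
    refine (abs_sub _ _).trans ?_
    rw [abs_mul]
    have a0 := bd0 t ht
    have a1 := mb1 t ht
    have a2 := mg1 t ht
    gcongr
  have D0 : DvOn 0 1 (fun t => g0 t / b0 t) (fun t => (g1 t - g0 t / b0 t * b1 t) / b0 t) := by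
    intro t ht
    have hne := (hbp t ht).ne'
    refine ((dg0 t ht).div (db0 t ht) hne).congr_deriv ?_
    field_simp
  refine ⟨fun t => g0 t / b0 t, fun t => (g1 t - g0 t / b0 t * b1 t) / b0 t,
    fun t => (g2 t - (g1 t - g0 t / b0 t * b1 t) / b0 t * b1 t
      - ((g1 t - g0 t / b0 t * b1 t) / b0 t * b1 t + g0 t / b0 t * b2 t)) / b0 t, D0, ?_, ?_, ?_, ?_⟩
  · intro t ht
    have hne := (hbp t ht).ne'
    refine (((dg1 t ht).sub ((D0 t ht).mul (db1 t ht))).div (db0 t ht) hne).congr_deriv ?_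
    simp only [Pi.sub_apply, Pi.mul_apply]
    field_simp
    ring
  · intro t ht
    exact mul_div_cancel₀ _ (hbp t ht).ne'
  · intro t ht
    have : 0 ≤ R2 / β := by positivity
    linarith [bd0 t ht]
  · intro t ht
    have : β * (R0 + R2 / β) = β * R0 + R2 := by field_simp
    rw [this]
    have h0 : 0 ≤ β * R0 := by positivity
    have a0 := bd0 t ht
    have a1 := bd1 t ht
    have : |(g2 t - (g1 t - g0 t / b0 t * b1 t) / b0 t * b1 t
      - ((g1 t - g0 t / b0 t * b1 t) / b0 t * b1 t + g0 t / b0 t * b2 t)) / b0 t| ≤ R2 := by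
      apply q t ht
      have c1 := mb1 t ht
      have c2 := mb2 t ht
      have c3 := mg2 t ht
      refine (abs_sub _ _).trans ?_
      refine add_le_add ((abs_sub _ _).trans ?_) ((abs_add_le _ _).trans ?_)
      · rw [abs_mul _ (b1 t)]; gcongr
      · rw [abs_mul _ (b1 t), abs_mul _ (b2 t)]; gcongr
    linarith

/-- ε-uniform second-order (up to logarithmic factor) convergence
of the discrete scheme for the linear problem on the Shishkin mesh with
`γ₀ = min(√β, 1)`. -/
theorem stmt_7 (b g : ℝ → ℝ → ℝ) (β : ℝ) (hβ : 0 < β)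
    (hb : UnifC3 b) (hg : UnifC3 g)
    (hbβ : ∀ x ∈ Icc (0:ℝ) 1, ∀ ε ∈ Icc (0:ℝ) 1, β ≤ b x ε) :
    ∃ C : ℝ, 0 < C ∧
      ∀ ε ∈ Ioc (0:ℝ) 1, ∀ n : ℕ, 4 ≤ n → 4 ∣ n →
      ∀ u : ℝ → ℝ,
        IsLinSolution (fun x => b x ε) (fun x => g x ε) ε u →
        (∃ y : ℕ → ℝ, LinScheme (fun x => b x ε) (fun x => g x ε) ε
            (shishkinMesh (min (Real.sqrt β) 1) ε n) n y) ∧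
        (∀ y y' : ℕ → ℝ,
          LinScheme (fun x => b x ε) (fun x => g x ε) ε
            (shishkinMesh (min (Real.sqrt β) 1) ε n) n y →
          LinScheme (fun x => b x ε) (fun x => g x ε) ε
            (shishkinMesh (min (Real.sqrt β) 1) ε n) n y' →
          ∀ i ≤ n, y i = y' i) ∧
        (∀ y : ℕ → ℝ,
          LinScheme (fun x => b x ε) (fun x => g x ε) ε
            (shishkinMesh (min (Real.sqrt β) 1) ε n) n y →
          ∀ i ≤ n,
            |u (shishkinMesh (min (Real.sqrt β) 1) ε n i) - y i| ≤
              C * ((n:ℝ) ^ 2)⁻¹ * (Real.log n) ^ 2) := by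
  obtain ⟨Mb, hb⟩ := hb
  obtain ⟨Mg, hg⟩ := hg
  set γ := min (Real.sqrt β) 1 with hγdef
  have hsq : 0 < Real.sqrt β := Real.sqrt_pos.2 hβ
  have hγ : 0 < γ := lt_min hsq one_pos
  have hγ1 : γ ≤ 1 := min_le_right _ _
  have hγβ : γ^2 ≤ β := by
    calc γ^2 ≤ (Real.sqrt β)^2 := by gcongr; exact min_le_left _ _
      _ = β := Real.sq_sqrt hβ.le
  set M := |Mb| + |Mg| with hMdef
  have hM : 0 ≤ M := by positivity
  have hMb : Mb ≤ M := by linarith [le_abs_self Mb, abs_nonneg Mg]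
  have hMg : Mg ≤ M := by linarith [le_abs_self Mg, abs_nonneg Mb]
  obtain ⟨K, hK, hr⟩ := quot_bounds hβ hM
  set C0 := M * (50 * K + 10 * (M*K+β*K)) with hC0
  have hC0p : 0 ≤ C0 := by positivity
  have hKp : 0 < Kc γ := by unfold Kc; positivity
  refine ⟨Kc γ * C0 * (β⁻¹ + 2 * γ⁻¹) + 1, by positivity, ?_⟩
  intro ε hε n hn4 hdvd u hu
  obtain ⟨m, rfl⟩ := hdvd
  have hm : 1 ≤ m := by omega
  have hm0 : (1:ℝ) ≤ m := by exact_mod_cast hm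
  have hε0 : 0 < ε := hε.1
  have hεI : ε ∈ Icc (0:ℝ) 1 := ⟨hε.1.le, hε.2⟩
  obtain ⟨cb, bb⟩ := hb ε hεI
  obtain ⟨cg, bg⟩ := hg ε hεI
  have hbβ' : ∀ t ∈ Icc (0:ℝ) 1, β ≤ b t ε := fun t ht => hbβ t ht ε hεI
  have hcast : ((4*m : ℕ) : ℝ) = 4 * m := by push_cast; ring
  have hl1 : 1 ≤ Real.log ((4*m : ℕ) : ℝ) := by
    rw [Real.le_log_iff_exp_le (by rw [hcast]; positivity), hcast]
    linarith [Real.exp_one_lt_d9]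
  have hMesh := shishkin_isMesh (γ := γ) (ε := ε) hm
  have hγi : 0 < γ⁻¹ := by positivity
  set α := min (1/4) (2 * γ⁻¹ * ε * Real.log ((4*m : ℕ) : ℝ)) with hα
  have hα0 : 0 < α := lt_min (by norm_num) (by positivity)
  have hα4 : α ≤ 1/4 := min_le_left _ _
  have hα1 : α ≤ 2 * γ⁻¹ * ε * Real.log ((4*m : ℕ) : ℝ) := min_le_right _ _
  have hαc : α = 1/4 ∨ α = 2 * γ⁻¹ * ε * Real.log ((4*m : ℕ) : ℝ) := min_choice _ _
  have hδ : m * (α / m) = α := by field_simp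
  have hH : 2 * m * ((1 - 2 * α) / (2 * m)) = 1 - 2 * α := by field_simp
  have hδ0 : 0 < α / m := by positivity
  have hH0 : 0 < (1 - 2 * α) / (2 * m) := by
    apply div_pos <;> linarith
  obtain ⟨x0, x1, xm, xI⟩ := mesh_bd hMesh hm hδ hH hδ0 hH0
  have hpos : ∀ i, 1 ≤ i → i < 4*m → 0 < b (shishkinMesh γ ε (4*m) i) ε := fun i _ h2 =>
    lt_of_lt_of_le hβ (hbβ' _ (xI i h2.le))
  refine ⟨disc_exists (bc := fun x => b x ε) (by omega) xm hpos, fun y y' hy hy' =>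
    disc_unique (bc := fun x => b x ε) xm hpos hy hy', fun y hy i hi => ?_⟩
  have bb0 : ∀ t ∈ Icc (0:ℝ) 1, |b t ε| ≤ M := fun t ht => by
    have := bb 0 (by norm_num) t ht
    rw [iteratedDerivWithin_zero] at this
    exact this.trans hMb
  have bg0 : ∀ t ∈ Icc (0:ℝ) 1, |g t ε| ≤ M := fun t ht => by
    have := bg 0 (by norm_num) t ht
    rw [iteratedDerivWithin_zero] at this
    exact this.trans hMg
  obtain ⟨cu, eu, ul, ur⟩ := hu
  obtain ⟨r0, r1, r2, hr0, hr1, hrb, hr0b, hr2b⟩ := hr (fun x => b x ε) _ _ (fun x => g x ε) _ _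
    (dv_zero cb (by norm_num)) (dv_iter cb 1 (by norm_num))
    (dv_zero cg (by norm_num)) (dv_iter cg 1 (by norm_num)) hbβ'
    (fun t ht => (bb 1 (by norm_num) t ht).trans hMb)
    (fun t ht => (bb 2 (by norm_num) t ht).trans hMb)
    bg0
    (fun t ht => (bg 1 (by norm_num) t ht).trans hMg)
    (fun t ht => (bg 2 (by norm_num) t ht).trans hMg)
  have cr : ContinuousOn r0 (Icc 0 1) := fun t ht => (hr0 t ht).continuousWithinAt
  have eq2 : ∀ t ∈ Icc (0:ℝ) 1, iteratedDerivWithin 2 u (Icc (0:ℝ) 1) t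
      = b t ε * (u t - r0 t) / ε^2 := by
    have hEq : EqOn (iteratedDerivWithin 2 u (Icc (0:ℝ) 1)) 
        (fun t => b t ε * (u t - r0 t) / ε^2) (Ioo 0 1) := by
      intro t ht
      have e1 := eu t ht
      have e2 := hrb t (Ioo_subset_Icc_self ht)
      beta_reduce at e1 e2 ⊢
      rw [eq_div_iff (by positivity)]
      linear_combination e2 - e1
    have := hEq.of_subset_closure (cu.continuousOn_iteratedDerivWithin (m := 2) (by norm_num)
      (uniqueDiffOn_Icc zero_lt_one)) (((cb.continuousOn).mul (cu.continuousOn.sub cr)).div_const _)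
      Ioo_subset_Icc_self (by rw [closure_Ioo (by norm_num)])
    exact this
  have du0 : DvOn 0 1 u (iteratedDerivWithin 1 u (Icc (0:ℝ) 1)) := dv_zero cu (by norm_num)
  have du1 : DvOn 0 1 (iteratedDerivWithin 1 u (Icc (0:ℝ) 1))
      (fun t => b t ε * (u t - r0 t) / ε^2) := by
    intro t ht
    exact (dv_iter cu 1 (by norm_num) t ht).congr_deriv (eq2 t ht)
  obtain ⟨u3, u4, d2, d3, hB⟩ := apriori (b0 := fun x => b x ε) hγ hγ1 hγβ hε0 hε.2 du0 du1
    (dv_zero cb (by norm_num)) (dv_iter cb 1 (by norm_num)) hr0 hr1 hM hK hbβ'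
    bb0
    (fun t ht => (bb 1 (by norm_num) t ht).trans hMb)
    (fun t ht => (bb 2 (by norm_num) t ht).trans hMb) hr0b hr2b ul ur
  have fin := error_bound (bc := fun x => b x ε) (gc := fun x => g x ε) hγ hβ hε0 hε.2 du0 du1 d2 d3 hC0p hB hMesh hm hδ hH hδ0 hH0
    ((4*m : ℕ) : ℝ) _ hcast rfl hl1 hα1 hαc hbβ' (fun t ht => by
      have := hrb t ht
      beta_reduce at this ⊢
      rw [← this]; field_simp; ring) ul ur hy i hi
  refine fin.trans ?_
  have hp : 0 ≤ Real.log ((4*m : ℕ) : ℝ) ^ 2 / ((4*m : ℕ) : ℝ) ^ 2 := by positivity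
  rw [mul_assoc _ (_⁻¹), inv_mul_eq_div]
  gcongr
  linarith
end
end

section
/- Fix q ∈ (0,1/2) and a > 0 with a√β ≥ 2. There exists a constant C > 0, independent of ε and n, such that for every ε ∈ (0,1] with aε < q and every integer n ≥ 2, the solution u of the continuous linear problem and the unique solution y of the discrete scheme on the Bakhvalov mesh satisfy max_{0≤i≤n} |u(x_i) − y_i| ≤ C n^{−2}. -/
open Set Real

noncomputable section

lemma aux_taylor2 {G G1 G2 : ℝ → ℝ} {A B P x y : ℝ}
    (hx : x ∈ Icc A B) (hy : y ∈ Icc A B)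
    (h1 : ∀ s ∈ Icc A B, HasDerivWithinAt G (G1 s) (Icc A B) s)
    (h2 : ∀ s ∈ Icc A B, HasDerivWithinAt G1 (G2 s) (Icc A B) s)
    (hP : ∀ s ∈ Icc A B, |G2 s| ≤ P) :
    |G y - G x - G1 x * (y - x)| ≤ P * (y - x) ^ 2 := by
  have hP0 : 0 ≤ P := (abs_nonneg _).trans (hP x hx)
  have hsub : uIcc x y ⊆ Icc A B := uIcc_subset_Icc hx hy
  have e1 : ∀ s ∈ Icc A B, |G1 s - G1 x| ≤ P * |s - x| := by
    intro s hs
    have := Convex.norm_image_sub_le_of_norm_hasDerivWithin_le (C := P) h2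
      (fun s hs => by simpa using hP s hs) (convex_Icc A B) hx hs
    simpa using this
  have e2 : ∀ s ∈ uIcc x y, HasDerivWithinAt (fun s => G s - G1 x * s) (G1 s - G1 x) (uIcc x y) s := by
    intro s hs
    have h := ((h1 s (hsub hs)).mono hsub).sub
      (((hasDerivAt_id s).const_mul (G1 x)).hasDerivWithinAt (s := uIcc x y))
    exact h.congr_deriv (by simp)
  have e3 : ∀ s ∈ uIcc x y, ‖G1 s - G1 x‖ ≤ P * |y - x| := by
    intro s hs
    refine (e1 s (hsub hs)).trans ?_
    exact mul_le_mul_of_nonneg_left (abs_sub_left_of_mem_uIcc hs) hP0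
  have := Convex.norm_image_sub_le_of_norm_hasDerivWithin_le e2 e3 (convex_uIcc x y)
    left_mem_uIcc right_mem_uIcc
  rw [Real.norm_eq_abs, Real.norm_eq_abs] at this
  calc |G y - G x - G1 x * (y - x)| = |G y - G1 x * y - (G x - G1 x * x)| := by congr 1; ring
    _ ≤ P * |y - x| * |y - x| := this
    _ = P * (y - x) ^ 2 := by rw [mul_assoc, abs_mul_abs_self]; ring

lemma aux_trunc {u u1 u2 : ℝ → ℝ} {xm x xp A B δ : ℝ} (hm : xm < x) (hp : x < xp)
    (h1 : ∀ s ∈ Icc xm xp, HasDerivWithinAt u (u1 s) (Icc xm xp) s)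
    (h2 : ∀ s ∈ Icc xm xp, HasDerivWithinAt u1 (u2 s) (Icc xm xp) s)
    (hδ : ∀ s ∈ Icc xm xp, |u2 s - A - B * (s - x)| ≤ δ) :
    |2 / (xp - xm) * ((u xp - u x) / (xp - x) - (u x - u xm) / (x - xm))
      - A - B * ((xp - x) - (x - xm)) / 3| ≤ 2 * δ := by
  have d1 : ∀ s ∈ Icc xm xp, HasDerivWithinAt
      (fun s => u s - (A / 2 * (s - x) ^ 2 + B / 6 * (s - x) ^ 3))
      (u1 s - (A * (s - x) + B / 2 * (s - x) ^ 2)) (Icc xm xp) s := by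
    intro s hs
    have i0 : HasDerivAt (fun s : ℝ => s - x) 1 s := (hasDerivAt_id s).sub_const x
    have i1 := ((i0.pow 2).const_mul (A / 2)).add ((i0.pow 3).const_mul (B / 6))
    refine ((h1 s hs).sub (i1.hasDerivWithinAt (s := Icc xm xp))).congr_deriv ?_
    simp; ring
  have d2 : ∀ s ∈ Icc xm xp, HasDerivWithinAt
      (fun s => u1 s - (A * (s - x) + B / 2 * (s - x) ^ 2))
      (u2 s - A - B * (s - x)) (Icc xm xp) s := by
    intro s hs
    have i0 : HasDerivAt (fun s : ℝ => s - x) 1 s := (hasDerivAt_id s).sub_const x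
    have i1 := (i0.const_mul A).add ((i0.pow 2).const_mul (B / 2))
    refine ((h2 s hs).sub (i1.hasDerivWithinAt (s := Icc xm xp))).congr_deriv ?_
    simp; ring
  have hx : x ∈ Icc xm xp := ⟨hm.le, hp.le⟩
  have p := aux_taylor2 hx (right_mem_Icc.2 (hm.trans hp).le) d1 d2 hδ
  have m := aux_taylor2 hx (left_mem_Icc.2 (hm.trans hp).le) d1 d2 hδ
  simp only [sub_self] at p m
  obtain ⟨a, ha⟩ : ∃ a, a = xp - x := ⟨_, rfl⟩
  obtain ⟨c, hc⟩ : ∃ c, c = x - xm := ⟨_, rfl⟩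
  have ha0 : 0 < a := by linarith
  have hc0 : 0 < c := by linarith
  have e1 : xm - x = -c := by linarith
  have e2 : xp - xm = a + c := by linarith
  rw [← ha] at p
  rw [e1] at m
  rw [e2, ← ha, ← hc]
  set Gp := u xp - (A / 2 * a ^ 2 + B / 6 * a ^ 3) - (u x - (A / 2 * 0 ^ 2 + B / 6 * 0 ^ 3)) -
      (u1 x - (A * 0 + B / 2 * 0 ^ 2)) * a with hGp
  set Gm := u xm - (A / 2 * (-c) ^ 2 + B / 6 * (-c) ^ 3) - (u x - (A / 2 * 0 ^ 2 + B / 6 * 0 ^ 3)) -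
      (u1 x - (A * 0 + B / 2 * 0 ^ 2)) * (-c) with hGm
  have key : 2 / (a + c) * ((u xp - u x) / a - (u x - u xm) / c) - A - B * (a - c) / 3
      = 2 / (a + c) * (Gp / a + Gm / c) := by
    rw [hGp, hGm]; field_simp; ring
  rw [key, abs_mul, abs_of_pos (by positivity : 0 < 2 / (a + c))]
  have b1 : |Gp / a| ≤ δ * a := by
    rw [abs_div, abs_of_pos ha0, div_le_iff₀ ha0]; linarith
  have b2 : |Gm / c| ≤ δ * c := by
    rw [abs_div, abs_of_pos hc0, div_le_iff₀ hc0]; linarith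
  calc 2 / (a + c) * |Gp / a + Gm / c| ≤ 2 / (a + c) * (δ * a + δ * c) := by
        gcongr; exact (abs_add_le _ _).trans (add_le_add b1 b2)
    _ = 2 * δ := by field_simp

lemma aux_maxprin {z z1 z2 : ℝ → ℝ}
    (h1 : ∀ s ∈ Icc (0:ℝ) 1, HasDerivWithinAt z (z1 s) (Icc 0 1) s)
    (h2 : ∀ s ∈ Icc (0:ℝ) 1, HasDerivWithinAt z1 (z2 s) (Icc 0 1) s)
    (h : ∀ s ∈ Ioo (0:ℝ) 1, z s < 0 → z2 s < 0)
    (h0 : 0 ≤ z 0) (h1' : 0 ≤ z 1) : ∀ s ∈ Icc (0:ℝ) 1, 0 ≤ z s := by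
  have hc : ContinuousOn z (Icc 0 1) := fun s hs => (h1 s hs).continuousWithinAt
  obtain ⟨x, hx, hmin⟩ := isCompact_Icc.exists_isMinOn (nonempty_Icc.2 zero_le_one) hc
  by_contra hneg
  push Not at hneg
  obtain ⟨s, hs, hs0⟩ := hneg
  have hx0 : z x < 0 := (hmin hs).trans_lt hs0
  have hxi : x ∈ Ioo (0:ℝ) 1 := by
    refine ⟨lt_of_le_of_ne hx.1 ?_, lt_of_le_of_ne hx.2 ?_⟩
    · rintro rfl; linarith
    · rintro rfl; linarith
  have hz2 := h x hxi hx0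
  have hlm : IsLocalMin z x := hmin.isLocalMin (Icc_mem_nhds hxi.1 hxi.2)
  have hev : ∀ᶠ y in nhds x, y ∈ Ioo (0:ℝ) 1 := Ioo_mem_nhds hxi.1 hxi.2
  have hd : ∀ y ∈ Ioo (0:ℝ) 1, HasDerivAt z (z1 y) y := fun y hy =>
    (h1 y (Ioo_subset_Icc_self hy)).hasDerivAt (Icc_mem_nhds hy.1 hy.2)
  have hd2 : HasDerivAt z1 (z2 x) x := (h2 x hx).hasDerivAt (Icc_mem_nhds hxi.1 hxi.2)
  have hde : deriv z =ᶠ[nhds x] z1 := by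
    filter_upwards [hev] with y hy using (hd y hy).deriv
  have hdd : deriv (deriv z) x = z2 x := by rw [hde.deriv_eq, hd2.deriv]
  have hM : IsLocalMax z x := isLocalMax_of_deriv_deriv_neg (by rw [hdd]; exact hz2)
    hlm.deriv_eq_zero (hd x hxi).continuousAt
  have hconst : z =ᶠ[nhds x] fun _ => z x := by
    filter_upwards [hlm, hM] with y a b using le_antisymm b a
  have : deriv (deriv z) x = 0 := by
    rw [hconst.deriv.deriv_eq]; simp
  linarith

/-- the two-sided layer function -/
def layE (γ ε x : ℝ) : ℝ := Real.exp (-γ * x / ε) + Real.exp (-γ * (1 - x) / ε)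

/-- first derivative of the layer function -/
def layE1 (γ ε x : ℝ) : ℝ :=
  (-γ / ε) * Real.exp (-γ * x / ε) + (γ / ε) * Real.exp (-γ * (1 - x) / ε)

lemma layE_pos (γ ε x : ℝ) : 0 < layE γ ε x := by unfold layE; positivity

lemma layE_symm (γ ε x : ℝ) : layE γ ε (1 - x) = layE γ ε x := by
  unfold layE; rw [add_comm]; simp

lemma layE_deriv (γ ε x : ℝ) : HasDerivAt (layE γ ε) (layE1 γ ε x) x := by
  have i0 : HasDerivAt (fun s : ℝ => -γ * s / ε) (-γ / ε) x := by
    simpa using (((hasDerivAt_id x).const_mul (-γ)).div_const ε)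
  have i1 : HasDerivAt (fun s : ℝ => -γ * (1 - s) / ε) (γ / ε) x := by
    simpa using ((((hasDerivAt_id x).const_sub 1).const_mul (-γ)).div_const ε)
  refine (i0.exp.add i1.exp).congr_deriv ?_
  unfold layE1; ring

lemma layE1_deriv (γ ε x : ℝ) : HasDerivAt (layE1 γ ε) ((γ / ε) ^ 2 * layE γ ε x) x := by
  have i0 : HasDerivAt (fun s : ℝ => -γ * s / ε) (-γ / ε) x := by
    simpa using (((hasDerivAt_id x).const_mul (-γ)).div_const ε)
  have i1 : HasDerivAt (fun s : ℝ => -γ * (1 - s) / ε) (γ / ε) x := by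
    simpa using ((((hasDerivAt_id x).const_sub 1).const_mul (-γ)).div_const ε)
  refine ((i0.exp.const_mul (-γ / ε)).add (i1.exp.const_mul (γ / ε))).congr_deriv ?_
  unfold layE; ring

lemma layE_near {γ ε x y : ℝ} (hγ : 0 ≤ γ) (hε : 0 < ε) (h : |y - x| ≤ ε) :
    layE γ ε y ≤ Real.exp γ * layE γ ε x := by
  have h' := abs_le.1 h
  unfold layE
  rw [mul_add, ← Real.exp_add, ← Real.exp_add]
  have e1 : -γ * y / ε ≤ γ + -γ * x / ε := by
    rw [div_le_iff₀ hε, add_mul, div_mul_cancel₀ _ hε.ne']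
    nlinarith
  have e2 : -γ * (1 - y) / ε ≤ γ + -γ * (1 - x) / ε := by
    rw [div_le_iff₀ hε, add_mul, div_mul_cancel₀ _ hε.ne']
    nlinarith
  gcongr

/-- bounds for `v = u - g/b` -/
lemma aux_vbound {β γ ε R : ℝ} (hβ : 0 < β) (hγ0 : 0 ≤ γ) (hγ : γ ^ 2 = β) (hε : 0 < ε)
    (hR : 0 ≤ R) {b v v1 r2 : ℝ → ℝ}
    (hb : ∀ s ∈ Icc (0:ℝ) 1, β ≤ b s)
    (h1 : ∀ s ∈ Icc (0:ℝ) 1, HasDerivWithinAt v (v1 s) (Icc 0 1) s)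
    (h2 : ∀ s ∈ Icc (0:ℝ) 1, HasDerivWithinAt v1 (b s * v s / ε ^ 2 - r2 s) (Icc 0 1) s)
    (hr : ∀ s ∈ Icc (0:ℝ) 1, |r2 s| ≤ R) (hv0 : |v 0| ≤ R) (hv1 : |v 1| ≤ R) :
    ∀ s ∈ Icc (0:ℝ) 1, |v s| ≤ (R / β + R) * (ε ^ 2 + layE γ ε s) := by
  have hbeta : 0 ≤ R / β := by positivity
  have E0 : 1 ≤ layE γ ε 0 := by
    unfold layE; simp; positivity
  have E1 : 1 ≤ layE γ ε 1 := by
    unfold layE; simp; positivity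
  have main : ∀ σ : ℝ, |σ| = 1 → ∀ s ∈ Icc (0:ℝ) 1,
      0 ≤ (R / β * ε ^ 2 + R * layE γ ε s) + σ * v s := by
    intro σ hσ
    refine aux_maxprin (z1 := fun s => R * layE1 γ ε s + σ * v1 s)
      (z2 := fun s => R * ((γ / ε) ^ 2 * layE γ ε s) + σ * (b s * v s / ε ^ 2 - r2 s))
      ?_ ?_ ?_ ?_ ?_
    · intro s hs
      refine ((((layE_deriv γ ε s).const_mul R).const_add (R / β * ε ^ 2)).hasDerivWithinAt.add
        ((h1 s hs).const_mul σ))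
    · intro s hs
      exact (((layE1_deriv γ ε s).const_mul R)).hasDerivWithinAt.add ((h2 s hs).const_mul σ)
    · intro s hs hneg
      have hsI := Ioo_subset_Icc_self hs
      have hb' := hb s hsI
      have hr' := hr s hsI
      have hE := layE_pos γ ε s
      have hsr : -(σ * r2 s) ≤ R := by
        have : |σ * r2 s| ≤ R := by rw [abs_mul, hσ, one_mul]; exact hr'
        exact (neg_le_abs _).trans this
      have e : ε ^ 2 * (R * ((γ / ε) ^ 2 * layE γ ε s) + σ * (b s * v s / ε ^ 2 - r2 s))
          = R * (β * layE γ ε s) + b s * (σ * v s) - ε ^ 2 * (σ * r2 s) := by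
        rw [← hγ]; field_simp; ring
      have hb0 : 0 < b s := by linarith
      have e2 : b s * (σ * v s) < - (b s * (R / β * ε ^ 2 + R * layE γ ε s)) := by nlinarith
      have e3 : β * (R / β * ε ^ 2 + R * layE γ ε s) ≤ b s * (R / β * ε ^ 2 + R * layE γ ε s) := by
        gcongr
      have e4 : β * (R / β * ε ^ 2 + R * layE γ ε s) = R * ε ^ 2 + R * (β * layE γ ε s) := by
        field_simp
      have e5 : ε ^ 2 * -(σ * r2 s) ≤ ε ^ 2 * R := by gcongr
      have : ε ^ 2 * (R * ((γ / ε) ^ 2 * layE γ ε s) + σ * (b s * v s / ε ^ 2 - r2 s)) < 0 := by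
        rw [e]; linarith
      by_contra hcon
      push Not at hcon
      have : 0 ≤ ε ^ 2 * (R * ((γ / ε) ^ 2 * layE γ ε s) + σ * (b s * v s / ε ^ 2 - r2 s)) := by
        positivity
      linarith
    · have : -(σ * v 0) ≤ R := by
        have : |σ * v 0| ≤ R := by rw [abs_mul, hσ, one_mul]; exact hv0
        exact (neg_le_abs _).trans this
      have : 0 ≤ R / β * ε ^ 2 := by positivity
      nlinarith
    · have : -(σ * v 1) ≤ R := by
        have : |σ * v 1| ≤ R := by rw [abs_mul, hσ, one_mul]; exact hv1
        exact (neg_le_abs _).trans this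
      have : 0 ≤ R / β * ε ^ 2 := by positivity
      nlinarith
  intro s hs
  have a1 := main 1 (by simp) s hs
  have a2 := main (-1) (by simp) s hs
  have hE := layE_pos γ ε s
  have : R / β * ε ^ 2 + R * layE γ ε s ≤ (R / β + R) * (ε ^ 2 + layE γ ε s) := by
    have : 0 ≤ R / β * layE γ ε s + R * ε ^ 2 := by positivity
    linarith
  rw [abs_le]; constructor <;> linarith

/-- bounds for the derivative of v -/
lemma aux_v1bound {γ ε R K M : ℝ} (hγ0 : 0 ≤ γ) (hε : 0 < ε) (hε1 : ε ≤ 1)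
    (hR : 0 ≤ R) (hK : 0 ≤ K) (hM : 0 ≤ M) {b v v1 r2 : ℝ → ℝ}
    (hb : ∀ s ∈ Icc (0:ℝ) 1, |b s| ≤ M)
    (h1 : ∀ s ∈ Icc (0:ℝ) 1, HasDerivWithinAt v (v1 s) (Icc 0 1) s)
    (h2 : ∀ s ∈ Icc (0:ℝ) 1, HasDerivWithinAt v1 (b s * v s / ε ^ 2 - r2 s) (Icc 0 1) s)
    (hr : ∀ s ∈ Icc (0:ℝ) 1, |r2 s| ≤ R)
    (hv : ∀ s ∈ Icc (0:ℝ) 1, |v s| ≤ K * (ε ^ 2 + layE γ ε s)) :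
    (∀ s ∈ Icc (0:ℝ) 1, |b s * v s / ε ^ 2 - r2 s| ≤ (M * K + R) * (1 + layE γ ε s / ε ^ 2)) ∧
    (∀ s ∈ Icc (0:ℝ) 1, |v1 s| ≤ (4 * K + M * K + R) * Real.exp γ * (ε + layE γ ε s / ε)) := by
  have A : ∀ s ∈ Icc (0:ℝ) 1, |b s * v s / ε ^ 2 - r2 s| ≤ (M * K + R) * (1 + layE γ ε s / ε ^ 2) := by
    intro s hs
    have hE := layE_pos γ ε s
    have e1 : |b s * v s / ε ^ 2| ≤ M * K * (1 + layE γ ε s / ε ^ 2) := by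
      rw [abs_div, abs_mul, abs_of_pos (by positivity : 0 < ε ^ 2), div_le_iff₀ (by positivity)]
      calc |b s| * |v s| ≤ M * (K * (ε ^ 2 + layE γ ε s)) :=
            mul_le_mul (hb s hs) (hv s hs) (abs_nonneg _) hM
        _ = _ := by field_simp
    have e2 : R ≤ R * (1 + layE γ ε s / ε ^ 2) := by
      have : 0 ≤ R * (layE γ ε s / ε ^ 2) := by positivity
      linarith
    have := abs_sub (b s * v s / ε ^ 2) (r2 s)
    have := hr s hs
    linarith
  refine ⟨A, ?_⟩
  intro x hx
  obtain ⟨d, hd, hy⟩ : ∃ d : ℝ, |d| = ε / 2 ∧ x + d ∈ Icc (0:ℝ) 1 := by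
    rcases le_total x (1/2) with h | h
    · exact ⟨ε / 2, abs_of_pos (by positivity), by linarith [hx.1], by linarith⟩
    · exact ⟨-(ε / 2), by rw [abs_neg, abs_of_pos (by positivity)], by linarith, by linarith [hx.2]⟩
  set X := Real.exp γ * layE γ ε x with hX
  have hX0 : 0 < X := mul_pos (Real.exp_pos _) (layE_pos _ _ _)
  have hsub : uIcc x (x + d) ⊆ Icc (0:ℝ) 1 := uIcc_subset_Icc hx hy
  have hnear : ∀ s ∈ uIcc x (x + d), layE γ ε s ≤ X := by
    intro s hs
    refine layE_near hγ0 hε ?_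
    have := abs_sub_left_of_mem_uIcc hs
    rw [add_sub_cancel_left, hd] at this
    linarith
  have hs' : uIcc x (x + d) = Icc (min x (x + d)) (max x (x + d)) := rfl
  have T := aux_taylor2 (G := v) (G1 := v1) (G2 := fun s => b s * v s / ε ^ 2 - r2 s)
    (A := min x (x + d)) (B := max x (x + d)) (P := (M * K + R) * (1 + X / ε ^ 2))
    (x := x) (y := x + d) (left_mem_uIcc) (right_mem_uIcc)
    (fun s hs => (h1 s (hsub hs)).mono hsub)
    (fun s hs => (h2 s (hsub hs)).mono hsub)
    (fun s hs => (A s (hsub hs)).trans (by have := hnear s hs; gcongr))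
  rw [add_sub_cancel_left] at T
  have b1 := hv x hx
  have b2 := hv _ hy
  have n1 := hnear x left_mem_uIcc
  have n2 := hnear _ right_mem_uIcc
  have c1 : |v x| ≤ K * (ε ^ 2 + X) := b1.trans (by gcongr)
  have c2 : |v (x + d)| ≤ K * (ε ^ 2 + X) := b2.trans (by gcongr)
  have hdd : d ^ 2 = ε ^ 2 / 4 := by rw [← sq_abs, hd]; ring
  rw [hdd] at T
  have t : |v1 x * d| ≤ 2 * (K * (ε ^ 2 + X)) + (M * K + R) * (1 + X / ε ^ 2) * (ε ^ 2 / 4) := by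
    have : v1 x * d = v (x + d) - v x - (v (x + d) - v x - v1 x * d) := by ring
    rw [this]
    have := abs_sub (v (x + d) - v x) (v (x + d) - v x - v1 x * d)
    have := abs_sub (v (x + d)) (v x)
    linarith
  have t2 : (M * K + R) * (1 + X / ε ^ 2) * (ε ^ 2 / 4) = (M * K + R) * (ε ^ 2 + X) / 4 := by
    field_simp
  rw [abs_mul, hd, t2] at t
  have t3 : |v1 x| ≤ (4 * K + M * K + R) * (ε + X / ε) := by
    have : ε + X / ε = (ε ^ 2 + X) / ε := by field_simp
    rw [this, ← mul_div_assoc, le_div_iff₀ hε]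
    have : 0 ≤ (M * K + R) * (ε ^ 2 + X) := by positivity
    nlinarith
  refine t3.trans ?_
  rw [mul_assoc]
  gcongr
  rw [mul_add, hX, ← mul_div_assoc]
  have : 1 ≤ Real.exp γ := Real.one_le_exp hγ0
  nlinarith

lemma aux_div_bound {x y M β : ℝ} (hβ : 0 < β) (hM : 0 ≤ M) (hx : |x| ≤ M) (hy : β ≤ y) :
    |x / y| ≤ M / β := by
  have hy0 : 0 < y := hβ.trans_le hy
  rw [abs_div, abs_of_pos hy0]
  exact div_le_div₀ hM hx hβ hy

lemma aux_mul_bound {x y A B : ℝ} (hx : |x| ≤ A) (hy : |y| ≤ B) : |x * y| ≤ A * B := by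
  rw [abs_mul]
  exact mul_le_mul hx hy (abs_nonneg _) ((abs_nonneg _).trans hx)

/-- the reduced solution `g/b` -/
lemma aux_reduced {β M : ℝ} (hβ : 0 < β) (hM : 0 ≤ M) :
    ∃ R : ℝ, 0 ≤ R ∧ ∀ b b1 b2 g g1 g2 : ℝ → ℝ,
      (∀ s ∈ Icc (0:ℝ) 1, β ≤ b s) →
      (∀ s ∈ Icc (0:ℝ) 1, |b s| ≤ M ∧ |b1 s| ≤ M ∧ |b2 s| ≤ M) →
      (∀ s ∈ Icc (0:ℝ) 1, |g s| ≤ M ∧ |g1 s| ≤ M ∧ |g2 s| ≤ M) →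
      (∀ s ∈ Icc (0:ℝ) 1, HasDerivWithinAt b (b1 s) (Icc 0 1) s) →
      (∀ s ∈ Icc (0:ℝ) 1, HasDerivWithinAt b1 (b2 s) (Icc 0 1) s) →
      (∀ s ∈ Icc (0:ℝ) 1, HasDerivWithinAt g (g1 s) (Icc 0 1) s) →
      (∀ s ∈ Icc (0:ℝ) 1, HasDerivWithinAt g1 (g2 s) (Icc 0 1) s) →
      ∃ r r1 r2 : ℝ → ℝ,
        (∀ s ∈ Icc (0:ℝ) 1, b s * r s = g s) ∧
        (∀ s ∈ Icc (0:ℝ) 1, |r s| ≤ R ∧ |r2 s| ≤ R) ∧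
        (∀ s ∈ Icc (0:ℝ) 1, HasDerivWithinAt r (r1 s) (Icc 0 1) s) ∧
        (∀ s ∈ Icc (0:ℝ) 1, HasDerivWithinAt r1 (r2 s) (Icc 0 1) s) := by
  set R0 := M / β with hR0
  set R1 := (M + R0 * M) / β with hR1
  set R2 := (M + 2 * (R1 * M) + R0 * M) / β with hR2
  have p0 : 0 ≤ R0 := by positivity
  have p1 : 0 ≤ R1 := by positivity
  have p2 : 0 ≤ R2 := by positivity
  refine ⟨R0 + R2, by positivity, ?_⟩
  intro b b1 b2 g g1 g2 hb hbM hgM db db1 dg dg1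
  have hb0 : ∀ s ∈ Icc (0:ℝ) 1, b s ≠ 0 := fun s hs => (hβ.trans_le (hb s hs)).ne'
  refine ⟨fun s => g s / b s, fun s => (g1 s - g s / b s * b1 s) / b s,
    fun s => (g2 s - 2 * ((g1 s - g s / b s * b1 s) / b s * b1 s) - g s / b s * b2 s) / b s,
    ?_, ?_, ?_, ?_⟩
  · intro s hs
    have := hb0 s hs
    field_simp
  · intro s hs
    obtain ⟨-, m1, m2⟩ := hbM s hs
    obtain ⟨n0, n1, n2⟩ := hgM s hs
    have q0 : |g s / b s| ≤ R0 := aux_div_bound hβ hM n0 (hb s hs)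
    have q0' := aux_mul_bound q0 m1
    have q0'' := aux_mul_bound q0 m2
    have q1 : |(g1 s - g s / b s * b1 s) / b s| ≤ R1 :=
      aux_div_bound hβ (by positivity) ((abs_sub _ _).trans (by linarith)) (hb s hs)
    have q1' := aux_mul_bound q1 m1
    have q2 : |(g2 s - 2 * ((g1 s - g s / b s * b1 s) / b s * b1 s) - g s / b s * b2 s) / b s| ≤ R2 := by
      refine aux_div_bound hβ (by positivity) ?_ (hb s hs)
      refine (abs_sub _ _).trans (add_le_add ((abs_sub _ _).trans (add_le_add n2 ?_)) q0'')
      rw [abs_mul, abs_two]; linarith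
    exact ⟨q0.trans (by linarith), q2.trans (by linarith)⟩
  · intro s hs
    have := hb0 s hs
    refine ((dg s hs).div (db s hs) this).congr_deriv ?_
    field_simp
  · intro s hs
    have := hb0 s hs
    have k := (((dg1 s hs).sub (((dg s hs).div (db s hs) this).mul (db1 s hs))).div (db s hs) this)
    refine k.congr_deriv ?_
    simp
    field_simp
    ring

lemma aux_core {β M : ℝ} (hβ : 0 < β) (hM : 0 ≤ M) :
    ∃ K : ℝ, 0 ≤ K ∧ ∀ (ε : ℝ) (b b1 b2 g g1 g2 u u1 : ℝ → ℝ), 0 < ε → ε ≤ 1 →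
      (∀ s ∈ Icc (0:ℝ) 1, β ≤ b s) →
      (∀ s ∈ Icc (0:ℝ) 1, |b s| ≤ M ∧ |b1 s| ≤ M ∧ |b2 s| ≤ M) →
      (∀ s ∈ Icc (0:ℝ) 1, |g s| ≤ M ∧ |g1 s| ≤ M ∧ |g2 s| ≤ M) →
      (∀ s ∈ Icc (0:ℝ) 1, HasDerivWithinAt b (b1 s) (Icc 0 1) s) →
      (∀ s ∈ Icc (0:ℝ) 1, HasDerivWithinAt b1 (b2 s) (Icc 0 1) s) →
      (∀ s ∈ Icc (0:ℝ) 1, HasDerivWithinAt g (g1 s) (Icc 0 1) s) →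
      (∀ s ∈ Icc (0:ℝ) 1, HasDerivWithinAt g1 (g2 s) (Icc 0 1) s) →
      (∀ s ∈ Icc (0:ℝ) 1, HasDerivWithinAt u (u1 s) (Icc 0 1) s) →
      (∀ s ∈ Icc (0:ℝ) 1, HasDerivWithinAt u1 ((b s * u s - g s) / ε ^ 2) (Icc 0 1) s) →
      u 0 = 0 → u 1 = 0 →
      ∀ xm x xp H D η : ℝ, 0 ≤ xm → xm < x → x < xp → xp ≤ 1 →
        x - xm ≤ H → xp - x ≤ H → |(xp - x) - (x - xm)| ≤ D →
        (∀ s ∈ Icc xm xp, layE (Real.sqrt β) ε s ≤ η) →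
        |ε ^ 2 * (2 / (xp - xm) * ((u xp - u x) / (xp - x) - (u x - u xm) / (x - xm)))
          - (b x * u x - g x)| ≤ K * (ε ^ 2 + η) ∧
        |ε ^ 2 * (2 / (xp - xm) * ((u xp - u x) / (xp - x) - (u x - u xm) / (x - xm)))
          - (b x * u x - g x)| ≤ K * (D * (ε + η / ε) + H ^ 2 * (1 + η / ε ^ 2)) := by
  obtain ⟨R, hR, hred⟩ := aux_reduced hβ hM
  set γ := Real.sqrt β with hγd
  have hγ0 : 0 ≤ γ := Real.sqrt_nonneg β
  have hγ : γ ^ 2 = β := Real.sq_sqrt hβ.le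
  set K0 := R / β + R with hK0
  have pK0 : 0 ≤ K0 := by positivity
  set K1 := (4 * K0 + M * K0 + R) * Real.exp γ with hK1
  have pK1 : 0 ≤ K1 := by positivity
  set K2 := M * K0 + R with hK2
  have pK2 : 0 ≤ K2 := by positivity
  set L := M * (K0 + 2 * K1 + K2) with hL
  have pL : 0 ≤ L := by positivity
  refine ⟨4 * L, by positivity, ?_⟩
  intro ε b b1 b2 g g1 g2 u u1 hε hε1 hb hbM hgM db db1 dg dg1 du du1 hu0 hu1
  obtain ⟨r, r1, r2, hbr, hrR, dr, dr1⟩ := hred b b1 b2 g g1 g2 hb hbM hgM db db1 dg dg1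
  have i0 : (0:ℝ) ∈ Icc (0:ℝ) 1 := by simp
  have i1 : (1:ℝ) ∈ Icc (0:ℝ) 1 := by simp
  have dv : ∀ s ∈ Icc (0:ℝ) 1, HasDerivWithinAt (fun s => u s - r s) (u1 s - r1 s) (Icc 0 1) s :=
    fun s hs => (du s hs).sub (dr s hs)
  have dv1 : ∀ s ∈ Icc (0:ℝ) 1, HasDerivWithinAt (fun s => u1 s - r1 s)
      (b s * (u s - r s) / ε ^ 2 - r2 s) (Icc 0 1) s := by
    intro s hs
    refine ((du1 s hs).sub (dr1 s hs)).congr_deriv ?_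
    rw [mul_sub, hbr s hs]
  have vb := aux_vbound (γ := γ) hβ hγ0 hγ hε hR hb dv dv1 (fun s hs => (hrR s hs).2)
    (by rw [hu0, zero_sub, abs_neg]; exact (hrR 0 i0).1)
    (by rw [hu1, zero_sub, abs_neg]; exact (hrR 1 i1).1)
  obtain ⟨v2b, v1b⟩ := aux_v1bound (γ := γ) hγ0 hε hε1 hR pK0 hM (fun s hs => (hbM s hs).1) dv dv1
    (fun s hs => (hrR s hs).2) vb
  rw [← hK0] at vb
  rw [← hK1] at v1b
  rw [← hK2] at v2b
  clear_value K0 K1 K2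
  set w1 : ℝ → ℝ := fun s => b1 s * (u s - r s) + b s * (u1 s - r1 s) with hw1
  set w2 : ℝ → ℝ := fun s => (b2 s * (u s - r s) + b1 s * (u1 s - r1 s)) +
    (b1 s * (u1 s - r1 s) + b s * (b s * (u s - r s) / ε ^ 2 - r2 s)) with hw2
  have dw : ∀ s ∈ Icc (0:ℝ) 1, HasDerivWithinAt (fun s => b s * (u s - r s)) (w1 s) (Icc 0 1) s :=
    fun s hs => (db s hs).mul (dv s hs)
  have dw1 : ∀ s ∈ Icc (0:ℝ) 1, HasDerivWithinAt w1 (w2 s) (Icc 0 1) s :=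
    fun s hs => ((db1 s hs).mul (dv s hs)).add ((db s hs).mul (dv1 s hs))
  -- bounds at a point where `layE ≤ η`
  have pt : ∀ s ∈ Icc (0:ℝ) 1, ∀ η : ℝ, layE γ ε s ≤ η →
      |b s * (u s - r s)| ≤ L * (ε ^ 2 + η) ∧ |w1 s| ≤ L * (ε + η / ε) ∧
        |w2 s| ≤ L * (1 + η / ε ^ 2) := by
    intro s hs η hη
    have hη0 : 0 < η := (layE_pos _ _ _).trans_le hη
    have a0 : |u s - r s| ≤ K0 * (ε ^ 2 + η) := (vb s hs).trans (by gcongr)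
    have a1 : |u1 s - r1 s| ≤ K1 * (ε + η / ε) := (v1b s hs).trans (by gcongr)
    have a2 : |b s * (u s - r s) / ε ^ 2 - r2 s| ≤ K2 * (1 + η / ε ^ 2) :=
      (v2b s hs).trans (by gcongr)
    obtain ⟨m0, m1, m2⟩ := hbM s hs
    have c1 : ε ^ 2 + η ≤ ε + η / ε := by
      have : ε + η / ε = (ε ^ 2 + η) / ε := by field_simp
      rw [this, le_div_iff₀ hε]
      have : 0 < ε ^ 2 + η := by positivity
      nlinarith
    have c2 : ε + η / ε ≤ 1 + η / ε ^ 2 := by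
      have : 1 + η / ε ^ 2 = (ε + η / ε) / ε := by field_simp
      rw [this, le_div_iff₀ hε]
      have : 0 < ε + η / ε := by positivity
      nlinarith
    have z0 : 0 ≤ ε ^ 2 + η := by positivity
    have z1 : 0 ≤ ε + η / ε := by positivity
    have z2 : 0 ≤ 1 + η / ε ^ 2 := by positivity
    refine ⟨?_, ?_, ?_⟩
    · refine (aux_mul_bound m0 a0).trans ?_
      rw [hL, ← mul_assoc]
      gcongr
      linarith
    · refine (abs_add_le _ _).trans ((add_le_add (aux_mul_bound m1 a0) (aux_mul_bound m0 a1)).trans ?_)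
      calc M * (K0 * (ε ^ 2 + η)) + M * (K1 * (ε + η / ε))
          ≤ M * (K0 * (ε + η / ε)) + M * (K1 * (ε + η / ε)) := by gcongr
        _ = M * (K0 + K1) * (ε + η / ε) := by ring
        _ ≤ L * (ε + η / ε) := by
            have : M * (K0 + K1) ≤ L := by
              rw [hL]
              exact mul_le_mul_of_nonneg_left (by linarith) hM
            gcongr
    · refine (abs_add_le _ _).trans ((add_le_add ((abs_add_le _ _).trans
        (add_le_add (aux_mul_bound m2 a0) (aux_mul_bound m1 a1))) ((abs_add_le _ _).trans
        (add_le_add (aux_mul_bound m1 a1) (aux_mul_bound m0 a2)))).trans ?_)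
      have c3 := c1.trans c2
      calc M * (K0 * (ε ^ 2 + η)) + M * (K1 * (ε + η / ε))
            + (M * (K1 * (ε + η / ε)) + M * (K2 * (1 + η / ε ^ 2)))
          ≤ M * (K0 * (1 + η / ε ^ 2)) + M * (K1 * (1 + η / ε ^ 2))
            + (M * (K1 * (1 + η / ε ^ 2)) + M * (K2 * (1 + η / ε ^ 2))) := by gcongr
        _ = L * (1 + η / ε ^ 2) := by rw [hL]; ring
  clear_value w1 w2 L
  intro xm x xp H D η hxm hmx hxp hxp1 hH1 hH2 hD hη
  have hsub : Icc xm xp ⊆ Icc (0:ℝ) 1 := Icc_subset_Icc hxm hxp1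
  have hxI : x ∈ Icc xm xp := ⟨hmx.le, hxp.le⟩
  have hη0 : 0 < η := (layE_pos _ _ _).trans_le (hη x hxI)
  have hu2 : ∀ s ∈ Icc (0:ℝ) 1, b s * u s - g s = b s * (u s - r s) := by
    intro s hs; rw [mul_sub, hbr s hs]
  rw [hu2 x (hsub hxI)]
  have dux : ∀ s ∈ Icc xm xp, HasDerivWithinAt u (u1 s) (Icc xm xp) s :=
    fun s hs => (du s (hsub hs)).mono hsub
  have du1x : ∀ s ∈ Icc xm xp, HasDerivWithinAt u1 (b s * (u s - r s) / ε ^ 2) (Icc xm xp) s := by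
    intro s hs
    have := (du1 s (hsub hs)).mono hsub
    rwa [hu2 s (hsub hs)] at this
  set Q := 2 / (xp - xm) * ((u xp - u x) / (xp - x) - (u x - u xm) / (x - xm)) with hQ
  have hε2 : 0 < ε ^ 2 := by positivity
  constructor
  · have t := aux_trunc (A := b x * (u x - r x) / ε ^ 2) (B := 0)
      (δ := 2 * (L * (ε ^ 2 + η)) / ε ^ 2) hmx hxp dux du1x (by
        intro s hs
        have e1 := (pt s (hsub hs) η (hη s hs)).1
        have e2 := (pt x (hsub hxI) η (hη x hxI)).1
        rw [zero_mul, sub_zero, ← sub_div, abs_div, abs_of_pos hε2]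
        gcongr
        have := abs_sub (b s * (u s - r s)) (b x * (u x - r x))
        linarith)
    rw [← hQ] at t
    have e : ε ^ 2 * Q - b x * (u x - r x) = ε ^ 2 * (Q - b x * (u x - r x) / ε ^ 2 - 
        0 * (xp - x - (x - xm)) / 3) := by field_simp; ring
    rw [e, abs_mul, abs_of_pos hε2]
    calc _ ≤ ε ^ 2 * (2 * (2 * (L * (ε ^ 2 + η)) / ε ^ 2)) := by gcongr
      _ = _ := by field_simp; ring
  · have hH0 : 0 ≤ H := by linarith
    have t := aux_trunc (A := b x * (u x - r x) / ε ^ 2) (B := w1 x / ε ^ 2)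
      (δ := (L * (1 + η / ε ^ 2) * H ^ 2) / ε ^ 2) hmx hxp dux du1x (by
        intro s hs
        have T := aux_taylor2 hxI hs (fun s hs => (dw s (hsub hs)).mono hsub)
          (fun s hs => (dw1 s (hsub hs)).mono hsub)
          (fun s hs => (pt s (hsub hs) η (hη s hs)).2.2)
        have e : b s * (u s - r s) / ε ^ 2 - b x * (u x - r x) / ε ^ 2 - w1 x / ε ^ 2 * (s - x)
          = (b s * (u s - r s) - b x * (u x - r x) - w1 x * (s - x)) / ε ^ 2 := by ring
        rw [e, abs_div, abs_of_pos hε2]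
        gcongr
        refine T.trans ?_
        have : (s - x) ^ 2 ≤ H ^ 2 := by
          apply sq_le_sq'
          · linarith [hs.1]
          · linarith [hs.2]
        gcongr)
    rw [← hQ] at t
    have e : ε ^ 2 * Q - b x * (u x - r x) = ε ^ 2 * (Q - b x * (u x - r x) / ε ^ 2 - 
        w1 x / ε ^ 2 * (xp - x - (x - xm)) / 3) + w1 x * (xp - x - (x - xm)) / 3 := by
      field_simp; ring
    have w1b := (pt x (hsub hxI) η (hη x hxI)).2.1
    have f1 := aux_mul_bound w1b hD
    have f2 : |ε ^ 2 * (Q - b x * (u x - r x) / ε ^ 2 - 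
        w1 x / ε ^ 2 * (xp - x - (x - xm)) / 3)| ≤ 2 * (L * (1 + η / ε ^ 2) * H ^ 2) := by
      rw [abs_mul, abs_of_pos hε2]
      calc _ ≤ ε ^ 2 * (2 * ((L * (1 + η / ε ^ 2) * H ^ 2) / ε ^ 2)) := by gcongr
        _ = _ := by field_simp
    rw [e]
    refine (abs_add_le _ _).trans ?_
    rw [abs_div, abs_of_pos (by norm_num : (0:ℝ) < 3)]
    have hD0 : 0 ≤ D := (abs_nonneg _).trans hD
    have g1 : 0 ≤ L * (ε + η / ε) * D := by positivity
    have g2 : 0 ≤ L * (1 + η / ε ^ 2) * H ^ 2 := by positivity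
    calc _ ≤ 2 * (L * (1 + η / ε ^ 2) * H ^ 2) + L * (ε + η / ε) * D := by
            refine add_le_add f2 ?_
            linarith [abs_nonneg (w1 x * (xp - x - (x - xm)))]
      _ ≤ 4 * (L * (1 + η / ε ^ 2) * H ^ 2) + 4 * (L * (ε + η / ε) * D) := by linarith
      _ = _ := by ring

/-- left half of the Bakhvalov mesh generating function -/
def bakhPsi (a ε q α t : ℝ) : ℝ :=
  if t ≤ α then bakhPhi a ε q t
  else bakhPhi a ε q α + bakhPhi' a ε q α * (t - α)

/-- slope of `bakhPsi` -/
def bakhSl (a ε q α t : ℝ) : ℝ := a * ε / (q - min t α)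

lemma aux_phi_bounds {a ε q s t : ℝ} (haε : 0 < a * ε) (hst : s ≤ t) (ht : t < q) :
    a * ε / (q - s) * (t - s) ≤ bakhPhi a ε q t - bakhPhi a ε q s ∧
    bakhPhi a ε q t - bakhPhi a ε q s ≤ a * ε / (q - t) * (t - s) ∨ q ≤ 0 := by
  by_cases hq : q ≤ 0
  · exact Or.inr hq
  left
  push Not at hq
  have h1 : 0 < q - t := by linarith
  have h2 : 0 < q - s := by linarith
  have e : bakhPhi a ε q t - bakhPhi a ε q s = a * ε * Real.log ((q - s) / (q - t)) := by
    unfold bakhPhi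
    rw [Real.log_div hq.ne' h1.ne', Real.log_div hq.ne' h2.ne', Real.log_div h2.ne' h1.ne']
    ring
  have hpos : 0 < (q - s) / (q - t) := by positivity
  have u := Real.log_le_sub_one_of_pos hpos
  have l := Real.one_sub_inv_le_log_of_pos hpos
  rw [e]
  constructor
  · have : a * ε / (q - s) * (t - s) = a * ε * (1 - ((q - s) / (q - t))⁻¹) := by
      field_simp; ring
    rw [this]; gcongr
  · have : a * ε / (q - t) * (t - s) = a * ε * ((q - s) / (q - t) - 1) := by
      field_simp; ring
    rw [this]; gcongr

lemma aux_psi_bounds {a ε q α s t : ℝ} (haε : 0 < a * ε) (hq : 0 < q) (hα : α < q) (hst : s ≤ t) :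
    bakhSl a ε q α s * (t - s) ≤ bakhPsi a ε q α t - bakhPsi a ε q α s ∧
    bakhPsi a ε q α t - bakhPsi a ε q α s ≤ bakhSl a ε q α t * (t - s) := by
  unfold bakhSl bakhPsi
  by_cases h1 : t ≤ α
  · have h2 : s ≤ α := hst.trans h1
    rw [if_pos h1, if_pos h2, min_eq_left h1, min_eq_left h2]
    rcases aux_phi_bounds (a := a) (ε := ε) haε hst (h1.trans_lt hα) with h | h
    · exact h
    · linarith
  · rw [if_neg h1]
    push Not at h1
    rw [min_eq_right h1.le]
    by_cases h2 : s ≤ α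
    · rw [if_pos h2, min_eq_left h2]
      rcases aux_phi_bounds (a := a) (ε := ε) haε h2 hα with h | h
      · unfold bakhPhi'
        have k : a * ε / (q - s) ≤ a * ε / (q - α) := by
          apply div_le_div_of_nonneg_left haε.le (by linarith) (by linarith)
        have k2 : a * ε / (q - s) * (t - α) ≤ a * ε / (q - α) * (t - α) := by
          apply mul_le_mul_of_nonneg_right k (by linarith)
        constructor
        · linarith [h.1]
        · linarith [h.2]
      · linarith
    · rw [if_neg h2]
      push Not at h2
      rw [min_eq_right h2.le]
      unfold bakhPhi'
      constructor <;> linarith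

lemma aux_lam_left {a ε q α t : ℝ} (ht : t ≤ 1/2) : bakhLam a ε q α t = bakhPsi a ε q α t := by
  unfold bakhLam bakhPsi
  simp only [if_pos ht]

lemma aux_lam_right {a ε q α t : ℝ} (hα : α < 1/2) (ht : 1/2 < t) :
    bakhLam a ε q α t = 1 - bakhPsi a ε q α (1 - t) := by
  unfold bakhLam bakhPsi
  rw [if_neg (by linarith), if_neg (by linarith)]

lemma aux_psi_half {a ε q α : ℝ} (hq : q < 1/2) (h : IsBakhAlpha a ε q α) :
    bakhPsi a ε q α (1/2) = 1/2 := by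
  unfold bakhPsi
  rw [if_neg (by linarith [h.1.2])]
  exact h.2

lemma aux_lam_symm {a ε q α : ℝ} (hq : q < 1/2) (h : IsBakhAlpha a ε q α) (t : ℝ) :
    bakhLam a ε q α (1 - t) = 1 - bakhLam a ε q α t := by
  have hα : α < 1/2 := h.1.2.trans hq
  rcases lt_trichotomy t (1/2) with ht | ht | ht
  · rw [aux_lam_right hα (by linarith), aux_lam_left ht.le, sub_sub_cancel]
  · have : (1:ℝ) - t = 1/2 := by linarith
    rw [this, ht, aux_lam_left le_rfl, aux_psi_half hq h]; norm_num
  · rw [aux_lam_right hα ht, aux_lam_left (by linarith), sub_sub_cancel]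

lemma aux_sl_pos {a ε q α t : ℝ} (haε : 0 < a * ε) (hα : α < q) : 0 < bakhSl a ε q α t := by
  unfold bakhSl
  have : min t α ≤ α := min_le_right _ _
  apply div_pos haε; linarith

lemma aux_psi_strict {a ε q α s t : ℝ} (haε : 0 < a * ε) (hq : 0 < q) (hα : α < q) (hst : s < t) :
    bakhPsi a ε q α s < bakhPsi a ε q α t := by
  have := (aux_psi_bounds (a := a) (ε := ε) haε hq hα hst.le).1
  have h2 : 0 < bakhSl a ε q α s * (t - s) := mul_pos (aux_sl_pos haε hα) (by linarith)
  linarith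

lemma aux_lam_strict {a ε q α : ℝ} (haε : 0 < a * ε) (hq0 : 0 < q) (hq : q < 1/2)
    (h : IsBakhAlpha a ε q α) : StrictMono (bakhLam a ε q α) := by
  intro s t hst
  have hα : α < 1/2 := h.1.2.trans hq
  have hh := aux_psi_half hq h
  rcases le_or_gt t (1/2) with ht | ht
  · rw [aux_lam_left ht, aux_lam_left (hst.le.trans ht)]
    exact aux_psi_strict haε hq0 h.1.2 hst
  · rw [aux_lam_right hα ht]
    rcases le_or_gt s (1/2) with hs | hs
    · rw [aux_lam_left hs]
      have e1 : bakhPsi a ε q α (1 - t) < 1/2 := by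
        rw [← hh]; exact aux_psi_strict haε hq0 h.1.2 (by linarith)
      have e2 : bakhPsi a ε q α s ≤ 1/2 := by
        rcases hs.lt_or_eq with hs | hs
        · rw [← hh]; exact (aux_psi_strict haε hq0 h.1.2 hs).le
        · rw [hs, hh]
      linarith
    · rw [aux_lam_right hα hs]
      have := aux_psi_strict (a := a) (ε := ε) haε hq0 h.1.2 (by linarith : 1 - t < 1 - s)
      linarith

lemma aux_lam_zero {a ε q α : ℝ} (hq0 : 0 < q) (h : IsBakhAlpha a ε q α) :
    bakhLam a ε q α 0 = 0 := by
  rw [aux_lam_left (by norm_num)]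
  unfold bakhPsi bakhPhi
  rw [if_pos h.1.1.le]
  simp [hq0.ne']

lemma aux_lam_one {a ε q α : ℝ} (hq0 : 0 < q) (hq : q < 1/2) (h : IsBakhAlpha a ε q α) :
    bakhLam a ε q α 1 = 1 := by
  have := aux_lam_symm hq h 0
  rw [aux_lam_zero hq0 h] at this
  simpa using this

/-- on `[α, 1-α]` the generating function is affine -/
lemma aux_lam_mid {a ε q α t : ℝ} (hq : q < 1/2) (h : IsBakhAlpha a ε q α)
    (h1 : α ≤ t) (h2 : t ≤ 1 - α) :
    bakhLam a ε q α t = bakhPhi a ε q α + bakhPhi' a ε q α * (t - α) := by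
  have hα : α < 1/2 := h.1.2.trans hq
  have key : ∀ s, α ≤ s → bakhPsi a ε q α s = bakhPhi a ε q α + bakhPhi' a ε q α * (s - α) := by
    intro s hs
    unfold bakhPsi
    split_ifs with h3
    · have : s = α := le_antisymm h3 hs
      rw [this]; ring
    · rfl
  rcases le_or_gt t (1/2) with ht | ht
  · rw [aux_lam_left ht, key t h1]
  · rw [aux_lam_right hα ht, key _ (by linarith)]
    have := h.2
    linarith

/-- two-sided bound for `q - α` -/
lemma aux_alpha {a ε q α : ℝ} (haε : 0 < a * ε) (hq0 : 0 < q) (hq : q < 1/2)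
    (h : IsBakhAlpha a ε q α) :
    a * (1 - 2 * q) * ε ≤ q - α ∧ q - α ≤ a * ε ∧ bakhPhi' a ε q α ≤ 1 / (1 - 2 * q)
      ∧ 0 ≤ bakhPhi a ε q α := by
  have hd : 0 < q - α := by linarith [h.1.2]
  have hα0 := h.1.1
  have e := h.2
  have z : bakhPhi a ε q 0 = 0 := by unfold bakhPhi; simp [hq0.ne']
  rcases aux_phi_bounds (a := a) (ε := ε) haε hα0.le h.1.2 with hb | hb
  swap; · linarith
  rw [z] at hb
  have hpd : bakhPhi' a ε q α * (q - α) = a * ε := by unfold bakhPhi'; field_simp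
  have hp : 0 < bakhPhi' a ε q α := by unfold bakhPhi'; positivity
  have hphi0 : 0 ≤ bakhPhi a ε q α := by
    have : 0 ≤ a * ε / (q - 0) * (α - 0) := by
      rw [sub_zero, sub_zero]; positivity
    linarith [hb.1]
  have hub : bakhPhi a ε q α ≤ bakhPhi' a ε q α * α := by
    have := hb.2; unfold bakhPhi'; linarith
  have hp1 : 1 ≤ bakhPhi' a ε q α := by linarith
  have hp2 : bakhPhi' a ε q α * (1 - 2 * q) ≤ 1 := by nlinarith [h.1.2]
  refine ⟨?_, by nlinarith, ?_, hphi0⟩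
  · calc a * (1 - 2 * q) * ε = (bakhPhi' a ε q α * (1 - 2 * q)) * (q - α) := by
          rw [mul_right_comm (bakhPhi' a ε q α), hpd]; ring
      _ ≤ 1 * (q - α) := by gcongr
      _ = q - α := one_mul _
  · rw [le_div_iff₀ (by linarith)]; exact hp2

/-- layer function on the mesh -/
lemma aux_exp_phi {a ε q γ t x : ℝ} (hε : 0 < ε) (hγ : 0 < γ) (haγ : 2 ≤ a * γ)
    (ht0 : 0 ≤ t) (ht : t < q) (hx : bakhPhi a ε q t ≤ x) :
    Real.exp (-γ * x / ε) ≤ (q - t) ^ 2 / q ^ 2 := by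
  have h1 : 0 < q - t := by linarith
  have hq : 0 < q := by linarith
  have hlog : 0 ≤ Real.log (q / (q - t)) := Real.log_nonneg (by rw [le_div_iff₀ h1]; linarith)
  have e1 : -γ * x / ε ≤ Real.log (((q - t) / q) ^ 2) := by
    rw [Real.log_pow, ← inv_div q, Real.log_inv, div_le_iff₀ hε]
    unfold bakhPhi at hx
    have k1 : γ * (a * ε * Real.log (q / (q - t))) ≤ γ * x := by gcongr
    have k2 : 2 * (ε * Real.log (q / (q - t))) ≤ a * γ * (ε * Real.log (q / (q - t))) := by gcongr
    push_cast
    linarith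
  calc Real.exp (-γ * x / ε) ≤ Real.exp (Real.log (((q - t) / q) ^ 2)) := Real.exp_le_exp.2 e1
    _ = (q - t) ^ 2 / q ^ 2 := by rw [Real.exp_log (by positivity), div_pow]

lemma aux_exp_half {ε γ x : ℝ} (hε : 0 < ε) (hγ : 0 < γ) (hx : x ≤ 1/2) :
    Real.exp (-γ * (1 - x) / ε) ≤ 8 / γ ^ 2 * ε ^ 2 := by
  set y := γ / (2 * ε) with hy
  have hy0 : 0 < y := by positivity
  have h1 : -γ * (1 - x) / ε ≤ -y := by
    rw [div_le_iff₀ hε]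
    have : -y * ε = -(γ / 2) := by rw [hy]; field_simp
    rw [this]; nlinarith
  have h2 : y ^ 2 / 2 ≤ Real.exp y := by
    have := Real.quadratic_le_exp_of_nonneg hy0.le
    linarith
  calc Real.exp (-γ * (1 - x) / ε) ≤ Real.exp (-y) := Real.exp_le_exp.2 h1
    _ = (Real.exp y)⁻¹ := Real.exp_neg y
    _ ≤ (y ^ 2 / 2)⁻¹ := by gcongr
    _ = 8 / γ ^ 2 * ε ^ 2 := by rw [hy]; field_simp; norm_num

/-- The mesh property used in the consistency estimate. -/
def MeshOK (γ ε C k xm x xp : ℝ) : Prop :=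
  ∃ H D η : ℝ, x - xm ≤ H ∧ xp - x ≤ H ∧ |(xp - x) - (x - xm)| ≤ D ∧
    (∀ s ∈ Icc xm xp, layE γ ε s ≤ η) ∧
    (ε ^ 2 + η ≤ C * k ^ 2 ∨ D * (ε + η / ε) + H ^ 2 * (1 + η / ε ^ 2) ≤ C * k ^ 2)

lemma MeshOK.symm {γ ε C k xm x xp : ℝ} (h : MeshOK γ ε C k xm x xp) :
    MeshOK γ ε C k (1 - xp) (1 - x) (1 - xm) := by
  obtain ⟨H, D, η, h1, h2, h3, h4, h5⟩ := h
  refine ⟨H, D, η, by linarith, by linarith, ?_, ?_, h5⟩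
  · rw [abs_sub_comm] at h3
    convert h3 using 2; ring
  · intro s hs
    rw [← layE_symm]
    exact h4 _ ⟨by linarith [hs.2], by linarith [hs.1]⟩

lemma MeshOK.mono {γ ε C C' k xm x xp : ℝ} (h : MeshOK γ ε C k xm x xp) (hC : C ≤ C') :
    MeshOK γ ε C' k xm x xp := by
  obtain ⟨H, D, η, h1, h2, h3, h4, h5⟩ := h
  have : C * k ^ 2 ≤ C' * k ^ 2 := by gcongr
  exact ⟨H, D, η, h1, h2, h3, h4, h5.imp (fun h => h.trans this) (fun h => h.trans this)⟩

lemma aux_mesh_mid {a ε q α γ k t : ℝ} (ha : 0 < a) (hε : 0 < ε) (hγ : 0 < γ) (haγ : 2 ≤ a * γ)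
    (hq0 : 0 < q) (hq : q < 1/2) (h : IsBakhAlpha a ε q α) (hk : 0 < k)
    (h1 : α ≤ t - k) (h2 : t + k ≤ 1 - α) :
    MeshOK γ ε ((1 / (1 - 2 * q)) ^ 2 * (1 + 2 * a ^ 2 / q ^ 2)) k
      (bakhLam a ε q α (t - k)) (bakhLam a ε q α t) (bakhLam a ε q α (t + k)) := by
  have haε : 0 < a * ε := by positivity
  obtain ⟨-, A2, A3, A4⟩ := aux_alpha haε hq0 hq h
  have hd : 0 < q - α := by linarith [h.1.2]
  have hp : 0 < bakhPhi' a ε q α := by unfold bakhPhi'; positivity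
  have hsm := (aux_lam_strict haε hq0 hq h).monotone
  have l1 : bakhPhi a ε q α ≤ bakhLam a ε q α (t - k) := by
    rw [aux_lam_mid hq h h1 (by linarith)]
    have : 0 ≤ bakhPhi' a ε q α * (t - k - α) := mul_nonneg hp.le (by linarith)
    linarith
  have l2 : bakhLam a ε q α (t + k) ≤ 1 - bakhPhi a ε q α := by
    rw [aux_lam_mid hq h (by linarith) h2]
    have : 0 ≤ bakhPhi' a ε q α * (1 - α - (t + k)) := mul_nonneg hp.le (by linarith)
    linarith [h.2]
  refine ⟨1 / (1 - 2 * q) * k, 0, 2 * a ^ 2 / q ^ 2 * ε ^ 2, ?_, ?_, ?_, ?_, Or.inr ?_⟩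
  · rw [aux_lam_mid hq h (by linarith) (by linarith), aux_lam_mid hq h h1 (by linarith)]
    nlinarith
  · rw [aux_lam_mid (t := t) hq h (by linarith) (by linarith), aux_lam_mid hq h (by linarith) h2]
    nlinarith
  · rw [aux_lam_mid (t := t) hq h (by linarith) (by linarith), aux_lam_mid hq h (by linarith) h2,
      aux_lam_mid hq h h1 (by linarith)]
    apply le_of_eq; rw [abs_eq_zero]; ring
  · intro s hs
    have e1 := aux_exp_phi hε hγ haγ h.1.1.le h.1.2 (l1.trans hs.1)
    have e2 := aux_exp_phi (x := 1 - s) hε hγ haγ h.1.1.le h.1.2 (by linarith [hs.2])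
    have e3 : (q - α) ^ 2 / q ^ 2 ≤ (a * ε) ^ 2 / q ^ 2 := by gcongr
    unfold layE
    calc _ ≤ (a * ε) ^ 2 / q ^ 2 + (a * ε) ^ 2 / q ^ 2 := by linarith
      _ = _ := by ring
  · apply le_of_eq; field_simp; ring

lemma aux_mesh_left {a q γ : ℝ} (ha : 0 < a) (hγ : 0 < γ) (haγ : 2 ≤ a * γ)
    (hq0 : 0 < q) (hq : q < 1/2) : ∃ C : ℝ, 0 ≤ C ∧ ∀ ε α k t : ℝ, 0 < ε →
    IsBakhAlpha a ε q α → 0 < k → k ≤ t → t - k < α → t + k ≤ 1/2 →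
    MeshOK γ ε C k
      (bakhLam a ε q α (t - k)) (bakhLam a ε q α t) (bakhLam a ε q α (t + k)) := by
  have hc : 0 < a * (1 - 2 * q) := mul_pos ha (by linarith)
  set c := a * (1 - 2 * q) with hcd
  set C1 := 1 / q ^ 2 + 8 / γ ^ 2 / c ^ 2 with hC1
  have hC10 : 0 < C1 := by positivity
  refine ⟨9 * (1 / c ^ 2 + C1) + (6 * a + 9 * a ^ 2) * (1 / c ^ 2 + C1), by positivity, ?_⟩
  intro ε α k t hε h hk hkt h1 h2
  have haε : 0 < a * ε := by positivity
  obtain ⟨A1, -, -, -⟩ := aux_alpha haε hq0 hq h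
  have hαq := h.1.2
  obtain ⟨s, hs⟩ : ∃ s, s = q - (t - k) := ⟨_, rfl⟩
  have hs0 : 0 < s := by linarith
  have hεs : c * ε ≤ s := by linarith
  have hε2 : ε ^ 2 ≤ 1 / c ^ 2 * s ^ 2 := by
    rw [div_mul_eq_mul_div, le_div_iff₀ (by positivity), one_mul]
    calc ε ^ 2 * c ^ 2 = (c * ε) ^ 2 := by ring
      _ ≤ s ^ 2 := by gcongr
  have hη : ∀ x ∈ Icc (bakhLam a ε q α (t - k)) (bakhLam a ε q α (t + k)),
      layE γ ε x ≤ C1 * s ^ 2 := by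
    intro x hx
    have e0 : bakhLam a ε q α (t - k) = bakhPhi a ε q (t - k) := by
      rw [aux_lam_left (by linarith)]; unfold bakhPsi; rw [if_pos h1.le]
    have e1 := aux_exp_phi (t := t - k) hε hγ haγ (by linarith) (by linarith) (e0 ▸ hx.1)
    have hx2 : x ≤ 1/2 := by
      refine hx.2.trans (((aux_lam_strict haε hq0 hq h).monotone h2).trans ?_)
      rw [aux_lam_left le_rfl, aux_psi_half hq h]
    have e2 := aux_exp_half hε hγ hx2
    rw [← hs] at e1
    have e3 : 8 / γ ^ 2 * ε ^ 2 ≤ 8 / γ ^ 2 * (1 / c ^ 2 * s ^ 2) := by gcongr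
    unfold layE
    calc _ ≤ s ^ 2 / q ^ 2 + 8 / γ ^ 2 * (1 / c ^ 2 * s ^ 2) := by linarith
      _ = _ := by rw [hC1]; ring
  rw [aux_lam_left (by linarith : t - k ≤ 1/2), aux_lam_left (by linarith : t ≤ 1/2),
    aux_lam_left h2] at *
  have P1 := aux_psi_bounds (a := a) (ε := ε) haε hq0 hαq (by linarith : t - k ≤ t)
  have P2 := aux_psi_bounds (a := a) (ε := ε) haε hq0 hαq (by linarith : t ≤ t + k)
  have Z : 0 ≤ 1 / c ^ 2 + C1 := by positivity
  by_cases hsk : s ≤ 3 * k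
  · refine ⟨max (bakhPsi a ε q α t - bakhPsi a ε q α (t - k))
      (bakhPsi a ε q α (t + k) - bakhPsi a ε q α t), _, C1 * s ^ 2, le_max_left _ _,
      le_max_right _ _, le_rfl, hη, Or.inl ?_⟩
    have : s ^ 2 ≤ (3 * k) ^ 2 := by gcongr
    calc ε ^ 2 + C1 * s ^ 2 ≤ (1 / c ^ 2 + C1) * s ^ 2 := by linarith
      _ ≤ (1 / c ^ 2 + C1) * (3 * k) ^ 2 := by gcongr
      _ = 9 * (1 / c ^ 2 + C1) * k ^ 2 := by ring
      _ ≤ _ := by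
        have : 0 ≤ (6 * a + 9 * a ^ 2) * (1 / c ^ 2 + C1) := by positivity
        gcongr
        linarith
  · push Not at hsk
    have mp : s / 3 ≤ q - min (t + k) α := by
      have := min_le_left (t + k) α
      linarith
    have mm : min (t - k) α = t - k := min_eq_left h1.le
    have slp : bakhSl a ε q α (t + k) ≤ 3 * (a * ε) / s := by
      unfold bakhSl
      rw [div_le_div_iff₀ (by linarith) hs0]
      nlinarith
    have slt : bakhSl a ε q α t ≤ bakhSl a ε q α (t + k) := by
      unfold bakhSl
      apply div_le_div_of_nonneg_left haε.le (by linarith)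
      have : min t α ≤ min (t + k) α := min_le_min_right _ (by linarith)
      linarith
    have sld : bakhSl a ε q α (t + k) - bakhSl a ε q α (t - k) ≤ 6 * (a * ε) * k / s ^ 2 := by
      unfold bakhSl
      rw [mm, ← hs]
      set m := min (t + k) α with hm
      have hm2 : s - (q - m) ≤ 2 * k := by
        have := min_le_left (t + k) α
        linarith
      have hqm : 0 < q - m := by linarith
      have e : a * ε / (q - m) - a * ε / s = a * ε * (s - (q - m)) / ((q - m) * s) := by
        field_simp
      rw [e]
      calc a * ε * (s - (q - m)) / ((q - m) * s) ≤ a * ε * (2 * k) / (s / 3 * s) := by gcongr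
        _ = _ := by field_simp; norm_num
    have eq1 : t - (t - k) = k := by ring
    have eq2 : t + k - t = k := by ring
    rw [eq1] at P1
    rw [eq2] at P2
    have q1 : bakhSl a ε q α t * k ≤ bakhSl a ε q α (t + k) * k := by gcongr
    have q2 : bakhSl a ε q α (t + k) * k ≤ 3 * (a * ε) / s * k := by gcongr
    have q3 : (bakhSl a ε q α (t + k) - bakhSl a ε q α (t - k)) * k
      ≤ 6 * (a * ε) * k / s ^ 2 * k := by gcongr
    refine ⟨3 * (a * ε) / s * k, 6 * (a * ε) * k / s ^ 2 * k, C1 * s ^ 2, by linarith [P1.2],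
      by linarith [P2.2], ?_, hη, Or.inr ?_⟩
    · have : 0 ≤ 6 * (a * ε) * k / s ^ 2 * k := by positivity
      rw [abs_le]; constructor
      · linarith [P1.2, P2.1]
      · linarith [P1.1, P2.2]
    · have r : ε ^ 2 / s ^ 2 ≤ 1 / c ^ 2 := by
        rw [div_le_iff₀ (by positivity)]; exact hε2
      calc _ = (6 * a + 9 * a ^ 2) * (ε ^ 2 / s ^ 2 + C1) * k ^ 2 := by
            field_simp; ring
        _ ≤ (6 * a + 9 * a ^ 2) * (1 / c ^ 2 + C1) * k ^ 2 := by gcongr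
        _ ≤ _ := by
          gcongr
          linarith

lemma aux_mesh {a q γ : ℝ} (ha : 0 < a) (hγ : 0 < γ) (haγ : 2 ≤ a * γ)
    (hq0 : 0 < q) (hq : q < 1/2) : ∃ C : ℝ, 0 ≤ C ∧ ∀ ε α k t : ℝ, 0 < ε → ε ≤ 1 →
    IsBakhAlpha a ε q α → 0 < k → k ≤ t → t ≤ 1 - k →
    MeshOK γ ε C k
      (bakhLam a ε q α (t - k)) (bakhLam a ε q α t) (bakhLam a ε q α (t + k)) := by
  obtain ⟨C0, hC0, hl⟩ := aux_mesh_left ha hγ haγ hq0 hq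
  set k0 := (1/2 - q) / 2 with hk0
  have hk0p : 0 < k0 := by rw [hk0]; linarith
  set C2 := (1 / (1 - 2 * q)) ^ 2 * (1 + 2 * a ^ 2 / q ^ 2) with hC2
  have hC2p : 0 ≤ C2 := by positivity
  have hC3 : 0 ≤ 3 / k0 ^ 2 := by positivity
  refine ⟨C0 + C2 + 3 / k0 ^ 2, by positivity, ?_⟩
  intro ε α k t hε hε1 h hk h1 h2
  have haε : 0 < a * ε := by positivity
  by_cases hkk : k0 < k
  · refine ⟨max (bakhLam a ε q α t - bakhLam a ε q α (t - k))
      (bakhLam a ε q α (t + k) - bakhLam a ε q α t), _, 2, le_max_left _ _,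
      le_max_right _ _, le_rfl, ?_, Or.inl ?_⟩
    · intro s hs
      have m := (aux_lam_strict haε hq0 hq h).monotone
      have s0 : 0 ≤ s := by
        rw [← aux_lam_zero hq0 h]
        exact (m (by linarith)).trans hs.1
      have s1 : s ≤ 1 := by
        rw [← aux_lam_one hq0 hq h]
        exact hs.2.trans (m (by linarith))
      unfold layE
      have e1 : Real.exp (-γ * s / ε) ≤ 1 := by
        rw [Real.exp_le_one_iff, div_le_iff₀ hε]; nlinarith
      have e2 : Real.exp (-γ * (1 - s) / ε) ≤ 1 := by
        rw [Real.exp_le_one_iff, div_le_iff₀ hε]; nlinarith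
      linarith
    · have : k0 ^ 2 ≤ k ^ 2 := by gcongr
      have e3 : 3 ≤ 3 / k0 ^ 2 * k ^ 2 := by
        rw [div_mul_eq_mul_div, le_div_iff₀ (by positivity)]; linarith
      have e4 : 0 ≤ (C0 + C2) * k ^ 2 := by positivity
      nlinarith
  · push Not at hkk
    by_cases c1 : t - k < α
    · exact (hl ε α k t hε h hk h1 c1 (by linarith [h.1.2])).mono (by linarith)
    · by_cases c2 : 1 - α < t + k
      · have := (hl ε α k (1 - t) hε h hk (by linarith) (by linarith) (by linarith [h.1.2])).symm
        have e1 : 1 - t - k = 1 - (t + k) := by ring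
        have e2 : 1 - t + k = 1 - (t - k) := by ring
        rw [e1, e2, aux_lam_symm hq h, aux_lam_symm hq h, aux_lam_symm hq h,
          sub_sub_cancel, sub_sub_cancel, sub_sub_cancel] at this
        exact this.mono (by linarith)
      · exact (aux_mesh_mid ha hε hγ haγ hq0 hq h hk (by linarith) (by linarith)).mono
          (by linarith)

lemma aux_ddiff_sub (x y z : ℕ → ℝ) (i : ℕ) :
    ddiff x (fun j => y j - z j) i = ddiff x y i - ddiff x z i := by
  unfold ddiff; ring

lemma aux_dmax {x e bb : ℕ → ℝ} {n : ℕ} {ε β T : ℝ} (hβ : 0 < β) (hT : 0 ≤ T)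
    (hx : ∀ i, i < n → x i < x (i + 1)) (hb : ∀ i, 1 ≤ i → i < n → β ≤ bb i)
    (h : ∀ i, 1 ≤ i → i < n → -ε ^ 2 * ddiff x e i + bb i * e i ≤ T)
    (h0 : e 0 = 0) (hn : e n = 0) : ∀ i ≤ n, e i ≤ T / β := by
  obtain ⟨j, hj, hmax⟩ := Finset.exists_max_image (Finset.range (n + 1)) e ⟨0, by simp⟩
  have hTβ : 0 ≤ T / β := by positivity
  have main : e j ≤ T / β := by
    have hjn : j ≤ n := by simpa [Nat.lt_succ_iff] using hj
    rcases Nat.eq_zero_or_pos j with rfl | hj0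
    · rw [h0]; exact hTβ
    rcases hjn.eq_or_lt with rfl | hjn
    · rw [hn]; exact hTβ
    have m1 := hmax (j - 1) (by simp; omega)
    have m2 := hmax (j + 1) (by simp; omega)
    have x1 : x (j - 1) < x j := by
      have := hx (j - 1) (by omega)
      rwa [Nat.sub_add_cancel hj0] at this
    have x2 := hx j hjn
    have hd : ddiff x e j ≤ 0 := by
      unfold ddiff
      have a1 : (e (j + 1) - e j) / (x (j + 1) - x j) ≤ 0 :=
        div_nonpos_of_nonpos_of_nonneg (by linarith) (by linarith)
      have a2 : 0 ≤ (e j - e (j - 1)) / (x j - x (j - 1)) :=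
        div_nonneg (by linarith) (by linarith)
      have a3 : 0 ≤ 2 / (x (j + 1) - x (j - 1)) := div_nonneg (by norm_num) (by linarith)
      exact mul_nonpos_of_nonneg_of_nonpos a3 (by linarith)
    have hh := h j hj0 hjn
    have hbj := hb j hj0 hjn
    rcases le_or_gt (e j) 0 with hneg | hpos
    · exact hneg.trans hTβ
    · rw [le_div_iff₀ hβ]
      have : 0 ≤ ε ^ 2 * (-ddiff x e j) := mul_nonneg (sq_nonneg _) (by linarith)
      nlinarith
  intro i hi
  exact (hmax i (by simp; omega)).trans main

lemma aux_dstab {x e bb : ℕ → ℝ} {n : ℕ} {ε β T : ℝ} (hβ : 0 < β) (hT : 0 ≤ T)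
    (hx : ∀ i, i < n → x i < x (i + 1)) (hb : ∀ i, 1 ≤ i → i < n → β ≤ bb i)
    (h : ∀ i, 1 ≤ i → i < n → |-ε ^ 2 * ddiff x e i + bb i * e i| ≤ T)
    (h0 : e 0 = 0) (hn : e n = 0) : ∀ i ≤ n, |e i| ≤ T / β := by
  intro i hi
  have a1 := aux_dmax (ε := ε) hβ hT hx hb (fun i h1 h2 => (le_abs_self _).trans (h i h1 h2)) h0 hn i hi
  have a2 := aux_dmax (e := fun j => 0 - e j) (ε := ε) hβ hT hx hb (fun i h1 h2 => by
    rw [aux_ddiff_sub x (fun _ => 0) e i]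
    have z : ddiff x (fun _ => (0:ℝ)) i = 0 := by unfold ddiff; simp
    rw [z]
    have := (neg_le_abs _).trans (h i h1 h2)
    linarith) (by simp [h0]) (by simp [hn]) i hi
  rw [abs_le]; constructor <;> linarith

/-- extension of a finite vector by zero -/
def extV (n : ℕ) (y : Fin (n + 1) → ℝ) (k : ℕ) : ℝ := if h : k < n + 1 then y ⟨k, h⟩ else 0

/-- matrix of the discrete scheme, as a linear map -/
def schemeMap (n : ℕ) (ε : ℝ) (x bb : ℕ → ℝ) : (Fin (n + 1) → ℝ) →ₗ[ℝ] (Fin (n + 1) → ℝ) where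
  toFun y i := if 1 ≤ (i : ℕ) ∧ (i : ℕ) < n then
    -ε ^ 2 * ddiff x (extV n y) i + bb i * extV n y i else extV n y i
  map_add' y z := by
    have he : ∀ k, extV n (y + z) k = extV n y k + extV n z k := by
      intro k; unfold extV; split_ifs <;> simp
    ext i
    simp only [Pi.add_apply]
    split_ifs
    · unfold ddiff; rw [he, he, he]; ring
    · rw [he]
  map_smul' c y := by
    have he : ∀ k, extV n (c • y) k = c * extV n y k := by
      intro k; unfold extV; split_ifs <;> simp
    ext i
    simp only [Pi.smul_apply, smul_eq_mul, RingHom.id_apply]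
    split_ifs
    · unfold ddiff; rw [he, he, he]; ring
    · rw [he]

lemma aux_exists {x bb gg : ℕ → ℝ} {n : ℕ} {ε β : ℝ} (hβ : 0 < β)
    (hx : ∀ i, i < n → x i < x (i + 1)) (hb : ∀ i, 1 ≤ i → i < n → β ≤ bb i) :
    ∃ y : ℕ → ℝ, (∀ i, 1 ≤ i → i < n → -ε ^ 2 * ddiff x y i + bb i * y i = gg i) ∧
      y 0 = 0 ∧ y n = 0 := by
  have app : ∀ (y : Fin (n + 1) → ℝ) (i : ℕ) (hi : i < n + 1), schemeMap n ε x bb y ⟨i, hi⟩ =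
      if 1 ≤ i ∧ i < n then
      -ε ^ 2 * ddiff x (extV n y) i + bb i * extV n y i else extV n y i := fun y i hi => rfl
  have hinj : Function.Injective (schemeMap n ε x bb) := by
    rw [injective_iff_map_eq_zero]
    intro y hy
    have hi : ∀ (i : ℕ) (hi : i < n + 1), (if 1 ≤ i ∧ i < n then
      -ε ^ 2 * ddiff x (extV n y) i + bb i * extV n y i else extV n y i) = 0 := by
      intro i hi
      rw [← app y i hi, hy]; rfl
    have s := aux_dstab (e := extV n y) (ε := ε) hβ le_rfl hx hb (fun i h1 h2 => by
        have := hi i (by omega)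
        rw [if_pos ⟨h1, h2⟩] at this
        rw [this]; simp)
      (by have := hi 0 (by omega); rwa [if_neg (by omega)] at this)
      (by have := hi n (by omega); rwa [if_neg (by omega)] at this)
    ext i
    have := s i (by omega)
    rw [zero_div] at this
    have h0 := abs_nonpos_iff.1 this
    unfold extV at h0
    rw [dif_pos i.2] at h0
    exact h0
  have hsurj := LinearMap.injective_iff_surjective.1 hinj
  obtain ⟨y, hy⟩ := hsurj (fun i => if 1 ≤ (i : ℕ) ∧ (i : ℕ) < n then gg i else 0)
  have hi : ∀ (i : ℕ) (hi : i < n + 1), (if 1 ≤ i ∧ i < n then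
      -ε ^ 2 * ddiff x (extV n y) i + bb i * extV n y i else extV n y i) =
      if 1 ≤ i ∧ i < n then gg i else 0 := by
    intro i hi
    rw [← app y i hi, hy]
  refine ⟨extV n y, ?_, ?_, ?_⟩
  · intro i h1 h2
    have := hi i (by omega)
    rwa [if_pos ⟨h1, h2⟩, if_pos ⟨h1, h2⟩] at this
  · have := hi 0 (by omega)
    rwa [if_neg (by omega), if_neg (by omega)] at this
  · have := hi n (by omega)
    rwa [if_neg (by omega), if_neg (by omega)] at this

lemma aux_hasDeriv {f : ℝ → ℝ} {N : WithTop ℕ∞} {m : ℕ} (hf : ContDiffOn ℝ N f (Icc (0:ℝ) 1))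
    (hm : (m : WithTop ℕ∞) < N) : ∀ s ∈ Icc (0:ℝ) 1,
    HasDerivWithinAt (iteratedDerivWithin m f (Icc 0 1))
      (iteratedDerivWithin (m + 1) f (Icc 0 1) s) (Icc 0 1) s := by
  intro s hs
  have := (hf.differentiableOn_iteratedDerivWithin hm (uniqueDiffOn_Icc zero_lt_one)) s hs
  rw [iteratedDerivWithin_succ]
  exact this.hasDerivWithinAt

/-- ε-uniform second-order convergence of the discrete scheme for
the linear problem on the Bakhvalov mesh. -/
theorem stmt_8 (b g : ℝ → ℝ → ℝ) (β : ℝ) (hβ : 0 < β)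
    (hb : UnifC3 b) (hg : UnifC3 g)
    (hbβ : ∀ x ∈ Icc (0:ℝ) 1, ∀ ε ∈ Icc (0:ℝ) 1, β ≤ b x ε)
    (q a : ℝ) (hq : q ∈ Ioo (0:ℝ) (1/2)) (ha : 0 < a)
    (haβ : 2 ≤ a * Real.sqrt β) :
    ∃ C : ℝ, 0 < C ∧
      ∀ ε ∈ Ioc (0:ℝ) 1, a * ε < q → ∀ n : ℕ, 2 ≤ n →
      ∀ α : ℝ, IsBakhAlpha a ε q α →
      ∀ u : ℝ → ℝ,
        IsLinSolution (fun x => b x ε) (fun x => g x ε) ε u →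
        (∃ y : ℕ → ℝ, LinScheme (fun x => b x ε) (fun x => g x ε) ε
            (bakhMesh a ε q α n) n y) ∧
        (∀ y y' : ℕ → ℝ,
          LinScheme (fun x => b x ε) (fun x => g x ε) ε (bakhMesh a ε q α n) n y →
          LinScheme (fun x => b x ε) (fun x => g x ε) ε (bakhMesh a ε q α n) n y' →
          ∀ i ≤ n, y i = y' i) ∧
        (∀ y : ℕ → ℝ,
          LinScheme (fun x => b x ε) (fun x => g x ε) ε (bakhMesh a ε q α n) n y →
          ∀ i ≤ n,
            |u (bakhMesh a ε q α n i) - y i| ≤ C * ((n:ℝ) ^ 2)⁻¹) := by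
  obtain ⟨Mb, hMb⟩ := hb
  obtain ⟨Mg, hMg⟩ := hg
  have z01 : (0:ℝ) ∈ Icc (0:ℝ) 1 := by simp
  have hM : 0 ≤ max Mb Mg :=
    le_max_of_le_left ((abs_nonneg _).trans ((hMb 0 z01).2 0 (by norm_num) 0 z01))
  set M := max Mb Mg with hMd
  set γ := Real.sqrt β with hγ
  have hγ0 : 0 < γ := Real.sqrt_pos.2 hβ
  obtain ⟨K, hK, core⟩ := aux_core hβ hM
  obtain ⟨C0, hC0, mesh⟩ := aux_mesh ha hγ0 haβ hq.1 hq.2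
  refine ⟨K * C0 / β + 1, by positivity, ?_⟩
  rintro ε ⟨hε, hε1⟩ - n hn α hα u ⟨hu, hueq, hu0, hu1⟩
  have haε : 0 < a * ε := by positivity
  have hεI : ε ∈ Icc (0:ℝ) 1 := ⟨hε.le, hε1⟩
  have hn0 : (0:ℝ) < n := by positivity
  have hsm := aux_lam_strict haε hq.1 hq.2 hα
  have x0 : bakhMesh a ε q α n 0 = 0 := by
    unfold bakhMesh; simp [aux_lam_zero hq.1 hα]
  have xn : bakhMesh a ε q α n n = 1 := by
    unfold bakhMesh; rw [div_self hn0.ne', aux_lam_one hq.1 hq.2 hα]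
  have xlt : ∀ i j : ℕ, i < j → bakhMesh a ε q α n i < bakhMesh a ε q α n j := by
    intro i j hij
    apply hsm
    have : (i:ℝ) < j := by exact_mod_cast hij
    gcongr
  have xmono : ∀ i j : ℕ, i ≤ j → bakhMesh a ε q α n i ≤ bakhMesh a ε q α n j := by
    intro i j hij
    rcases hij.eq_or_lt with rfl | h
    · exact le_rfl
    · exact (xlt i j h).le
  have xI : ∀ i ≤ n, bakhMesh a ε q α n i ∈ Icc (0:ℝ) 1 := by
    intro i hi
    exact ⟨x0 ▸ xmono 0 i (by omega), xn ▸ xmono i n hi⟩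
  have xinc : ∀ i, i < n → bakhMesh a ε q α n i < bakhMesh a ε q α n (i + 1) :=
    fun i _ => xlt i (i + 1) (by omega)
  have xb : ∀ i, 1 ≤ i → i < n → β ≤ b (bakhMesh a ε q α n i) ε :=
    fun i _ h => hbβ _ (xI i h.le) ε hεI
  refine ⟨?_, ?_, ?_⟩
  · exact aux_exists (ε := ε) (bb := fun i => b (bakhMesh a ε q α n i) ε)
      (gg := fun i => g (bakhMesh a ε q α n i) ε) hβ xinc xb
  · rintro y y' ⟨hy, hy0, hyn⟩ ⟨hy', hy0', hyn'⟩ i hi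
    have := aux_dstab (e := fun j => y j - y' j) (ε := ε) hβ le_rfl xinc xb (fun i h1 h2 => by
      have e1 := hy i h1 h2
      have e2 := hy' i h1 h2
      rw [aux_ddiff_sub]
      apply le_of_eq
      rw [abs_eq_zero]
      simp only at e1 e2
      linarith) (by simp [hy0, hy0']) (by simp [hyn, hyn']) i hi
    rw [zero_div] at this
    exact sub_eq_zero.1 (abs_nonpos_iff.1 this)
  · rintro y ⟨hy, hy0, hyn⟩
    obtain ⟨cb, bM⟩ := hMb ε hεI
    obtain ⟨cg, gM⟩ := hMg ε hεI
    have hu2 : EqOn (iteratedDerivWithin 2 u (Icc (0:ℝ) 1))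
        (fun s => (b s ε * u s - g s ε) / ε ^ 2) (Icc (0:ℝ) 1) := by
      have o : EqOn (iteratedDerivWithin 2 u (Icc (0:ℝ) 1))
          (fun s => (b s ε * u s - g s ε) / ε ^ 2) (Ioo (0:ℝ) 1) := by
        intro s hs
        have := hueq s hs
        simp only at this ⊢
        rw [eq_div_iff (by positivity)]
        linarith
      refine o.of_subset_closure
        (hu.continuousOn_iteratedDerivWithin le_rfl (uniqueDiffOn_Icc zero_lt_one)) ?_
        Ioo_subset_Icc_self (by rw [closure_Ioo zero_ne_one])
      exact ((cb.continuousOn.mul hu.continuousOn).sub cg.continuousOn).div_const _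
    have d0 : ∀ f : ℝ → ℝ, iteratedDerivWithin 0 f (Icc (0:ℝ) 1) = f := fun f =>
      iteratedDerivWithin_zero
    have db := aux_hasDeriv (m := 0) cb (by norm_num)
    have db1 := aux_hasDeriv (m := 1) cb (by norm_num)
    have dg := aux_hasDeriv (m := 0) cg (by norm_num)
    have dg1 := aux_hasDeriv (m := 1) cg (by norm_num)
    have du := aux_hasDeriv (m := 0) hu (by norm_num)
    have du1 := aux_hasDeriv (m := 1) hu (by norm_num)
    rw [d0] at db dg du
    have core' := core ε (fun s => b s ε) _ _ (fun s => g s ε) _ _ u _ hε hε1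
      (fun s hs => hbβ s hs ε hεI)
      (fun s hs => ⟨((d0 (fun x => b x ε)) ▸ bM 0 (by norm_num) s hs).trans (le_max_left _ _),
        (bM 1 (by norm_num) s hs).trans (le_max_left _ _),
        (bM 2 (by norm_num) s hs).trans (le_max_left _ _)⟩)
      (fun s hs => ⟨((d0 (fun x => g x ε)) ▸ gM 0 (by norm_num) s hs).trans (le_max_right _ _),
        (gM 1 (by norm_num) s hs).trans (le_max_right _ _),
        (gM 2 (by norm_num) s hs).trans (le_max_right _ _)⟩)
      db db1 dg dg1 du (fun s hs => (du1 s hs).congr_deriv (hu2 hs)) hu0 hu1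
    have hT : 0 ≤ K * (C0 * (1 / (n:ℝ)) ^ 2) := by positivity
    have trunc : ∀ i, 1 ≤ i → i < n →
        |ε ^ 2 * ddiff (bakhMesh a ε q α n) (fun j => u (bakhMesh a ε q α n j)) i
          - (b (bakhMesh a ε q α n i) ε * u (bakhMesh a ε q α n i) - g (bakhMesh a ε q α n i) ε)|
          ≤ K * (C0 * (1 / (n:ℝ)) ^ 2) := by
      intro i h1 h2
      have i1 : (1:ℝ) ≤ i := by exact_mod_cast h1
      have i2 : (i:ℝ) + 1 ≤ n := by exact_mod_cast h2
      have m := mesh ε α (1 / n) (i / n) hε hε1 hα (by positivity) (by gcongr) (by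
        rw [le_sub_iff_add_le, ← add_div, div_le_one hn0]; exact i2)
      have em : bakhLam a ε q α ((i:ℝ) / n - 1 / n) = bakhMesh a ε q α n (i - 1) := by
        unfold bakhMesh; rw [Nat.cast_sub h1, ← sub_div]; simp
      have ep : bakhLam a ε q α ((i:ℝ) / n + 1 / n) = bakhMesh a ε q α n (i + 1) := by
        unfold bakhMesh; rw [← add_div]; push_cast; rfl
      have e0 : bakhLam a ε q α ((i:ℝ) / n) = bakhMesh a ε q α n i := rfl
      rw [em, ep, e0] at m
      obtain ⟨H, D, η, m1, m2, m3, m4, m5⟩ := m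
      obtain ⟨c1, c2⟩ := core' _ _ _ H D η (xI (i - 1) (by omega)).1 (xlt (i - 1) i (by omega))
        (xlt i (i + 1) (by omega)) (xI (i + 1) (by omega)).2 m1 m2 m3 m4
      unfold ddiff
      rcases m5 with m5 | m5
      · exact c1.trans (mul_le_mul_of_nonneg_left m5 hK)
      · exact c2.trans (mul_le_mul_of_nonneg_left m5 hK)
    intro i hi
    have st := aux_dstab (e := fun j => u (bakhMesh a ε q α n j) - y j) (ε := ε) hβ hT xinc xb
      (fun i h1 h2 => by
        have e1 := hy i h1 h2
        have t := trunc i h1 h2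
        rw [aux_ddiff_sub]
        rw [← abs_neg] at t
        refine le_trans (le_of_eq ?_) t
        congr 1
        simp only at e1
        linarith) (by simp [hy0, x0, hu0]) (by simp [hyn, xn, hu1]) i hi
    refine st.trans ?_
    have : 0 ≤ ((n:ℝ) ^ 2)⁻¹ := by positivity
    calc K * (C0 * (1 / (n:ℝ)) ^ 2) / β = K * C0 / β * ((n:ℝ) ^ 2)⁻¹ := by field_simp
      _ ≤ (K * C0 / β + 1) * ((n:ℝ) ^ 2)⁻¹ := by gcongr; linarith
end
end
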